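/- arXiv:2204.11305 — 2 statements merged into one kernel-verified Lean document; each statement's English description precedes it below -/
import Mathlib

section
/- Let F be a field of characteristic 2. Every excellent field extension K/F belongs to E₂(F), i.e., K/F is excellent for the forms of I²_qF: for every anisotropic quadratic form φ ∈ I²_qF there exists ψ ∈ I²_qF with (φ_K)_an ≅ ψ_K. -/
open scoped TensorProduct

namespace BL

/-! ### Quadratic forms over a field, presented by matrices -/

/-- A quadratic form over `F` given by a square matrix `M` of size `n`:
the form is `v ↦ vᵀ M v`. Every quadratic form on a finite-dimensional
`F`-vector space is isometric to one of this shape. -/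
structure QF (F : Type) [Field F] : Type where
  n : ℕ
  M : Matrix (Fin n) (Fin n) F

namespace QF

variable {F K : Type} [Field F] [Field K]

/-- The quadratic form associated to the presentation. -/
noncomputable def form (q : QF F) : QuadraticForm F (Fin q.n → F) :=
  q.M.toQuadraticMap'

/-- Isometry of quadratic forms. -/
def Isom (p q : QF F) : Prop :=
  QuadraticMap.Equivalent p.form q.form

/-- Orthogonal sum. -/
def oplus (p q : QF F) : QF F :=
  ⟨p.n + q.n, Matrix.reindex finSumFinEquiv finSumFinEquiv (Matrix.fromBlocks p.M 0 0 q.M)⟩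

/-- Scaling a quadratic form by a scalar. -/
def sm (c : F) (q : QF F) : QF F := ⟨q.n, c • q.M⟩

/-- The zero-dimensional quadratic form. -/
def nil : QF F := ⟨0, 0⟩

/-- The binary quadratic form `[a, b] : (x, y) ↦ a x² + x y + b y²`. -/
def bin (a b : F) : QF F := ⟨2, !![a, 1; 0, b]⟩

/-- Orthogonal sum of a list of forms. -/
def sumList : List (QF F) → QF F := fun L => L.foldr oplus nil

/-- Orthogonal sum of a finite family of forms. -/
def sumFin {r : ℕ} (f : Fin r → QF F) : QF F := sumList (List.ofFn f)

/-- `hypN k` is an orthogonal sum of `k` hyperbolic planes `[0,0]`. -/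
def hypN (k : ℕ) : QF F := sumList (List.replicate k (bin 0 0))

/-- `zeroN j` is `j × ⟨0⟩`, the totally singular zero form of dimension `j`. -/
def zeroN (j : ℕ) : QF F := ⟨j, 0⟩

/-- The quadratic Pfister form `⟨⟨a₁, …, a_r⟩⟩_b ⊗ [1, b]`
(an `(r+1)`-fold quadratic Pfister form). -/
def qpf : List F → F → QF F
  | [], b => bin 1 b
  | a :: l, b => oplus (qpf l b) (sm a (qpf l b))

/-- A form is hyperbolic if it is isometric to a sum of hyperbolic planes. -/
def Hyperbolic (q : QF F) : Prop := ∃ k, Isom q (hypN k)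

/-- Witt equivalence of quadratic forms. -/
def WittEquiv (p q : QF F) : Prop :=
  ∃ k l, Isom (oplus p (hypN k)) (oplus q (hypN l))

/-- The Witt class of `q` is trivial. -/
def WittZero (q : QF F) : Prop := WittEquiv q nil

/-- A (matrix-presented) quadratic form is nonsingular iff its polar bilinear
form, with matrix `M + Mᵀ`, is nondegenerate. -/
def Nonsingular (q : QF F) : Prop := IsUnit (q.M + q.M.transpose)

/-- `ψ` is the anisotropic part of `q`: `ψ` is anisotropic and
`q ≅ ψ ⊥ i × [0,0] ⊥ j × ⟨0⟩` (Witt decomposition). -/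
def IsAnisoPartOf (q ψ : QF F) : Prop :=
  ψ.form.Anisotropic ∧ ∃ i j, Isom q (oplus ψ (oplus (hypN i) (zeroN j)))

/-- Transport of a quadratic form along a ring homomorphism. -/
def map (f : F →+* K) (q : QF F) : QF K := ⟨q.n, q.M.map f⟩

/-- Extension of scalars of a quadratic form to a field extension `K / F`. -/
def bc (K : Type) [Field K] [Algebra F K] (q : QF F) : QF K :=
  q.map (algebraMap F K)

/-- Membership in `I^m_q F`, the `(m-1)`-st power of the fundamental ideal times
the Witt group of quadratic forms: `q ∈ I^m_q F` iff `q` is Witt equivalent to a sum of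
scaled `m`-fold quadratic Pfister forms `c • ⟨⟨a₁, …, a_{m-1}⟩⟩ ⊗ [1, b]`. -/
def InIq (m : ℕ) (q : QF F) : Prop :=
  ∃ L : List (F × List F × F), (∀ t ∈ L, t.2.1.length + 1 = m) ∧
    WittEquiv q (sumList (L.map fun t => sm t.1 (qpf t.2.1 t.2.2)))

/-- Membership in `I^m F ⊗ [1, a] ⊆ I^{m+1}_q F`, the subgroup additively generated by the
forms `c • ⟨⟨a₁, …, a_m⟩⟩_b ⊗ [1, a]`. -/
def InImTimes (m : ℕ) (a : F) (q : QF F) : Prop :=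
  ∃ L : List (F × List F), (∀ t ∈ L, t.2.length = m) ∧
    WittEquiv q (sumList (L.map fun t => sm t.1 (qpf t.2 a)))

/-- Membership in `W(F) ⊗ [1, a]`, the subgroup additively generated by the
forms `c • [1, a]`. -/
def InWTimes (a : F) (q : QF F) : Prop :=
  ∃ L : List F, WittEquiv q (sumList (L.map fun c => sm c (bin 1 a)))

end QF

/-- `I^m_q F = 0`. -/
def IqZero (F : Type) [Field F] (m : ℕ) : Prop :=
  ∀ q : QF F, QF.InIq m q → QF.WittZero q

/-- `cd₂(F) ≤ c`: for every finite field extension `L/F` and every `m ≥ c` one has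
`I^{m+1}_q L = 0` (this is the characterization of the `2`-cohomological dimension via
Kato's isomorphism `H^{m+1,m}(L, ℤ/2) ≅ Ī^{m+1}_q L` and the Arason–Pfister Hauptsatz). -/
def Cd2Le (F : Type) [Field F] (c : ℕ) : Prop :=
  ∀ (L : Type) (_ : Field L) (_ : Algebra F L), FiniteDimensional F L →
    ∀ m : ℕ, c ≤ m → IqZero L (m + 1)

/-- `cd₂ F = c`. -/
def Cd2Eq (F : Type) [Field F] (c : ℕ) : Prop :=
  Cd2Le F c ∧ ∀ d : ℕ, Cd2Le F d → c ≤ d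

/-- An extension `K/F` is excellent if the anisotropic part of the extension to `K`
of any anisotropic `F`-form is defined over `F`. -/
def Excellent (F K : Type) [Field F] [Field K] [Algebra F K] : Prop :=
  ∀ φ : QF F, φ.form.Anisotropic → ∃ ψ : QF F, QF.IsAnisoPartOf (φ.bc K) (ψ.bc K)

/-- `K/F` is excellent for the forms of `I²_q F`, i.e. `K/F ∈ E₂(F)`. -/
def ExcellentI2 (F K : Type) [Field F] [Field K] [Algebra F K] : Prop :=
  ∀ φ : QF F, QF.InIq 2 φ → φ.form.Anisotropic →
    ∃ ψ : QF F, QF.InIq 2 ψ ∧ QF.IsAnisoPartOf (φ.bc K) (ψ.bc K)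

/-- `K/F` is a multiquadratic extension: a compositum of finitely many quadratic
extensions of `F`. -/
def IsMultiquadratic (F K : Type) [Field F] [Field K] [Algebra F K] : Prop :=
  ∃ (r : ℕ) (E : Fin r → IntermediateField F K),
    (∀ i, Module.finrank F (E i) = 2) ∧ (⨆ i, E i) = ⊤



/-! ### Central simple algebras, quaternion algebras in characteristic 2 -/

/-- A bundled (possibly noncommutative) `F`-algebra. -/
structure FAlg (F : Type) [Field F] : Type 1 where
  carrier : Type
  [ring : Ring carrier]
  [alg : Algebra F carrier]

attribute [instance] FAlg.ring FAlg.alg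

instance {F : Type} [Field F] : CoeSort (FAlg F) Type := ⟨FAlg.carrier⟩

variable (F : Type) [Field F]

/-- The defining relations of the quaternion algebra `[α, β)` in characteristic 2:
generators `i = ι 0`, `j = ι 1` with `i² + i = α`, `j² = β`, `ji = ij + j`
(the last being equivalent to `j i j⁻¹ = i + 1`). -/
inductive QuatRel (α β : F) : FreeAlgebra F (Fin 2) → FreeAlgebra F (Fin 2) → Prop
  | i_sq : QuatRel α β (FreeAlgebra.ι F 0 * FreeAlgebra.ι F 0 + FreeAlgebra.ι F 0)
      (algebraMap F _ α)
  | j_sq : QuatRel α β (FreeAlgebra.ι F 1 * FreeAlgebra.ι F 1) (algebraMap F _ β)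
  | comm : QuatRel α β (FreeAlgebra.ι F 1 * FreeAlgebra.ι F 0)
      (FreeAlgebra.ι F 0 * FreeAlgebra.ι F 1 + FreeAlgebra.ι F 1)

/-- The quaternion `F`-algebra `[α, β) = F⟨i, j : i² + i = α, j² = β, jij⁻¹ = i + 1⟩`
(characteristic 2). -/
def QuatAlg (α β : F) : Type := RingQuot (QuatRel F α β)

noncomputable instance (α β : F) : Ring (QuatAlg F α β) :=
  inferInstanceAs (Ring (RingQuot (QuatRel F α β)))

noncomputable instance (α β : F) : Algebra F (QuatAlg F α β) :=
  inferInstanceAs (Algebra F (RingQuot (QuatRel F α β)))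

variable (A : Type) [Ring A] [Algebra F A]

/-- An `F`-algebra is split if it is isomorphic to a matrix algebra over `F`. -/
def IsSplit : Prop :=
  ∃ m : ℕ, 0 < m ∧ Nonempty (A ≃ₐ[F] Matrix (Fin m) (Fin m) F)

/-- A central simple `F`-algebra has exponent 2 if its Brauer class has order exactly 2:
`A ⊗ A` is split but `A` is not. -/
def HasExponentTwo : Prop :=
  IsSplit F (A ⊗[F] A) ∧ ¬ IsSplit F A

/-- The index of a central simple `F`-algebra `A` is `d` if `A ≅ M_m(D)` for a
division `F`-algebra `D` of degree `d` (i.e. of dimension `d²`). -/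
def HasIndex (d : ℕ) : Prop :=
  ∃ D : FAlg F, (∀ x : D.carrier, x ≠ 0 → IsUnit x) ∧ Nontrivial D.carrier ∧
    Module.finrank F D.carrier = d ^ 2 ∧
    ∃ m : ℕ, 0 < m ∧ Nonempty (A ≃ₐ[F] Matrix (Fin m) (Fin m) D.carrier)

/-- `A` is a central division `F`-algebra of degree `2 ^ n`. -/
def IsCentralDivisionOfDegree (n : ℕ) : Prop :=
  Algebra.IsCentral F A ∧ Nontrivial A ∧ (∀ x : A, x ≠ 0 → IsUnit x) ∧
    Module.finrank F A = (2 ^ n) ^ 2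

/-- `A` is a central simple `F`-algebra of degree `2 ^ n`. -/
def IsCSAOfDegree (n : ℕ) : Prop :=
  Algebra.IsCentral F A ∧ IsSimpleRing A ∧ Module.finrank F A = (2 ^ n) ^ 2

variable (K : Type) [Field K] [Algebra F K]

/-- `A` admits a decomposition adapted to the multiquadratic extension `K/F`:
there are quadratic extensions `E₁, …, E_r` of `F` inside `K` with
`K = E₁ ⋯ E_r ≅ E₁ ⊗ ⋯ ⊗ E_r` (so `[K : F] = 2^r`), quaternion `F`-algebras
`Q_i = [αᵢ, βᵢ)` with `Eᵢ ⊂ Qᵢ`, and an algebra `A'` with `A ≅ Q₁ ⊗ ⋯ ⊗ Q_r ⊗ A'`. -/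
def AdaptedDecomp : Prop :=
  ∃ (r : ℕ) (E : Fin r → IntermediateField F K) (α β : Fin r → F),
    (∀ i, Module.finrank F (E i) = 2) ∧ (⨆ i, E i) = ⊤ ∧
    Module.finrank F K = 2 ^ r ∧
    (∀ i, β i ≠ 0) ∧
    (∀ i, Nonempty ((E i) →ₐ[F] QuatAlg F (α i) (β i))) ∧
    ∃ A' : FAlg F, Nonempty (A ≃ₐ[F] ((⨂[F] i, QuatAlg F (α i) (β i)) ⊗[F] A'.carrier))

end BL

namespace BL
namespace QF
variable {F : Type} [Field F]

lemma form_apply (q : QF F) (v : Fin q.n → F) :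
    q.form v = ∑ i, ∑ j, v i * q.M i j * v j := by
  unfold form
  simp only [Matrix.toQuadraticMap', Matrix.toQuadraticForm', LinearMap.BilinMap.toQuadraticMap_apply,
    Matrix.toLinearMap₂'_apply]
  simp [mul_assoc, mul_comm, mul_left_comm]

/-- splitting equivalence -/
def splitEquiv (F : Type) [Field F] (m n : ℕ) : ((Fin m → F) × (Fin n → F)) ≃ₗ[F] (Fin (m + n) → F) :=
  (LinearEquiv.sumArrowLequivProdArrow (Fin m) (Fin n) F F).symm.trans
    (LinearEquiv.funCongrLeft F F finSumFinEquiv.symm)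

@[simp] lemma splitEquiv_castAdd (m n : ℕ) (v : (Fin m → F) × (Fin n → F)) (i : Fin m) :
    splitEquiv F m n v (Fin.castAdd n i) = v.1 i := by
  simp [splitEquiv, LinearEquiv.funCongrLeft_apply, LinearMap.funLeft_apply]
  rfl

@[simp] lemma splitEquiv_natAdd (m n : ℕ) (v : (Fin m → F) × (Fin n → F)) (i : Fin n) :
    splitEquiv F m n v (Fin.natAdd m i) = v.2 i := by
  simp [splitEquiv, LinearEquiv.funCongrLeft_apply, LinearMap.funLeft_apply]
  rfl

lemma oplus_equiv (p q : QF F) :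
    (p.form.prod q.form).Equivalent (oplus p q).form := by
  refine ⟨⟨splitEquiv F p.n q.n, ?_⟩⟩
  intro v
  have := form_apply (oplus p q) (splitEquiv F p.n q.n v)
  refine this.trans ?_
  rw [QuadraticMap.prod_apply, form_apply, form_apply]
  show ∑ i : Fin (p.n + q.n), ∑ j : Fin (p.n + q.n), splitEquiv F p.n q.n v i *
    (Matrix.reindex finSumFinEquiv finSumFinEquiv (Matrix.fromBlocks p.M 0 0 q.M)) i j *
    splitEquiv F p.n q.n v j = _
  simp only [Fin.sum_univ_add, splitEquiv_castAdd, splitEquiv_natAdd]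
  simp [Matrix.reindex_apply]

lemma Isom.refl (p : QF F) : Isom p p := QuadraticMap.Equivalent.refl _
lemma Isom.symm {p q : QF F} (h : Isom p q) : Isom q p := QuadraticMap.Equivalent.symm h
lemma Isom.trans {p q r : QF F} (h : Isom p q) (h' : Isom q r) : Isom p r :=
  QuadraticMap.Equivalent.trans h h'

lemma Isom.oplus {p q p' q' : QF F} (h : Isom p p') (h' : Isom q q') :
    Isom (p.oplus q) (p'.oplus q') :=
  ((oplus_equiv p q).symm.trans (QuadraticMap.Equivalent.prod h h')).trans (oplus_equiv p' q')

lemma oplus_comm' (p q : QF F) : Isom (p.oplus q) (q.oplus p) :=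
  ((oplus_equiv p q).symm.trans ⟨QuadraticMap.IsometryEquiv.prodComm _ _⟩).trans (oplus_equiv q p)

lemma oplus_assoc' (p q r : QF F) : Isom ((p.oplus q).oplus r) (p.oplus (q.oplus r)) := by
  refine ((oplus_equiv _ r).symm.trans
    (QuadraticMap.Equivalent.prod (oplus_equiv p q).symm (QuadraticMap.Equivalent.refl _))).trans ?_
  refine QuadraticMap.Equivalent.trans ?_ ((QuadraticMap.Equivalent.prod
    (QuadraticMap.Equivalent.refl _) (oplus_equiv q r)).trans (oplus_equiv p _))
  refine ⟨⟨LinearEquiv.prodAssoc F _ _ _, ?_⟩⟩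
  rintro ⟨⟨a, b⟩, c⟩
  simp [add_assoc]

lemma nil_oplus' (p : QF F) : Isom (nil.oplus p) p := by
  refine (oplus_equiv _ p).symm.trans ?_
  have : Unique (Fin (nil : QF F).n → F) := by
    show Unique (Fin 0 → F)
    infer_instance
  refine ⟨⟨LinearEquiv.uniqueProd, ?_⟩⟩
  rintro ⟨a, b⟩
  have : a = 0 := Subsingleton.elim _ _
  subst this
  simp

instance stp (F : Type) [Field F] : Setoid (QF F) := ⟨Isom, Isom.refl, Isom.symm, Isom.trans⟩

/-- isometry classes -/
def Cls (F : Type) [Field F] : Type := Quotient (stp F)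

/-- class -/
def cl (p : QF F) : Cls F := Quotient.mk (stp F) p

lemma cl_eq {p q : QF F} : cl p = cl q ↔ Isom p q := Quotient.eq (r := stp F)

instance : Zero (Cls F) := ⟨cl nil⟩
instance : Add (Cls F) where
  add := Quotient.map₂ oplus (fun _ _ h _ _ h' => Isom.oplus h h')

instance : AddCommMonoid (Cls F) where
  nsmul := nsmulRec
  add_assoc a b c := by
    induction a using Quotient.inductionOn
    induction b using Quotient.inductionOn
    induction c using Quotient.inductionOn
    exact Quotient.sound (oplus_assoc' _ _ _)
  add_comm a b := by
    induction a using Quotient.inductionOn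
    induction b using Quotient.inductionOn
    exact Quotient.sound (oplus_comm' _ _)
  zero_add a := by
    induction a using Quotient.inductionOn
    exact Quotient.sound (nil_oplus' _)
  add_zero a := by
    induction a using Quotient.inductionOn
    exact Quotient.sound ((oplus_comm' _ _).trans (nil_oplus' _))

lemma cl_oplus (p q : QF F) : cl (oplus p q) = cl p + cl q := rfl
lemma cl_nil : cl (nil : QF F) = 0 := rfl

lemma cl_sumList (L : List (QF F)) : cl (sumList L) = (L.map cl).sum := by
  induction L with
  | nil => rfl
  | cons a L ih =>
    simp only [List.map_cons, List.sum_cons, ← ih]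
    rfl

/-- sum of planes -/
def PL (L : List (F × F)) : QF F := sumList (L.map fun t => bin t.1 t.2)

lemma cl_PL_cons (a b : F) (L : List (F × F)) : cl (PL ((a, b) :: L)) = cl (bin a b) + cl (PL L) := rfl
lemma cl_PL_nil : cl (PL ([] : List (F × F))) = 0 := rfl
lemma cl_PL_append (L L' : List (F × F)) : cl (PL (L ++ L')) = cl (PL L) + cl (PL L') := by
  simp [PL, cl_sumList]

lemma hypN_eq (k : ℕ) : (hypN k : QF F) = PL (List.replicate k (0, 0)) := by
  simp [hypN, PL]

lemma cl_hypN (k : ℕ) : cl (hypN k : QF F) = k • cl (bin 0 0 : QF F) := by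
  simp [hypN, cl_sumList]

/-- dimension on classes -/
lemma Isom.dim {p q : QF F} (h : Isom p q) : p.n = q.n := by
  obtain ⟨e⟩ := h
  have := e.toLinearEquiv.finrank_eq
  simpa using this

/-- matrix form of isometry -/
def MIsom (p q : QF F) : Prop := ∃ (P : Matrix (Fin q.n) (Fin p.n) F) (P' : Matrix (Fin p.n) (Fin q.n) F),
  P * P' = 1 ∧ P' * P = 1 ∧ (∀ i, (P.transpose * q.M * P) i i = p.M i i) ∧
  ∀ i j, (P.transpose * q.M * P) i j + (P.transpose * q.M * P) j i = p.M i j + p.M j i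

lemma form_apply' (q : QF F) (v : Fin q.n → F) : q.form v = v ⬝ᵥ (q.M.mulVec v) := by
  rw [form_apply]
  simp [dotProduct, Matrix.mulVec, Finset.mul_sum, mul_assoc]

lemma quad_eq {n : ℕ} (M N : Matrix (Fin n) (Fin n) F) :
    (∀ v : Fin n → F, v ⬝ᵥ M.mulVec v = v ⬝ᵥ N.mulVec v) ↔
     ((∀ i, M i i = N i i) ∧ ∀ i j, M i j + M j i = N i j + N j i) := by
  constructor
  · intro h
    have h1 : ∀ i, M i i = N i i := by
      intro i
      simpa using h (Pi.single i 1)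
    refine ⟨h1, ?_⟩
    intro i j
    have := h (Pi.single i 1 + Pi.single j 1)
    simp [Matrix.mulVec_add, h1] at this
    linear_combination this
  · rintro ⟨h1, h2⟩ v
    have key : ∀ M : Matrix (Fin n) (Fin n) F, v ⬝ᵥ M.mulVec v =
        ∑ i, M i i * (v i)^2 + ∑ i, ∑ j, if i < j then (M i j + M j i) * (v i * v j) else 0 := by
      intro M
      have e1 : v ⬝ᵥ M.mulVec v = ∑ i, ∑ j, v i * M i j * v j := by
        simp [dotProduct, Matrix.mulVec, Finset.mul_sum, mul_assoc]
      have e2 : ∀ i j, v i * M i j * v j = (if i = j then v i * M i j * v j else 0) +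
          (if i < j then v i * M i j * v j else 0) + (if j < i then v i * M i j * v j else 0) := by
        intro i j
        rcases lt_trichotomy i j with h | h | h
        · simp [h, h.ne, h.le]
        · simp [h]
        · simp [h, h.ne', h.le]
      rw [e1]
      rw [Finset.sum_congr rfl fun i _ => Finset.sum_congr rfl fun j _ => e2 i j]
      simp only [Finset.sum_add_distrib]
      rw [Finset.sum_comm (f := fun i j => if j < i then v i * M i j * v j else 0), add_assoc, ← Finset.sum_add_distrib]
      congr 1
      · simp
        exact Finset.sum_congr rfl fun i _ => by ring
      · refine Finset.sum_congr rfl fun i _ => ?_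
        rw [← Finset.sum_add_distrib]
        refine Finset.sum_congr rfl fun j _ => ?_
        split_ifs <;> ring
    rw [key, key]
    simp only [h1, h2]

lemma isom_iff (p q : QF F) : Isom p q ↔ MIsom p q := by
  have conv : ∀ P : Matrix (Fin q.n) (Fin p.n) F, (∀ v, q.form (P.mulVec v) = p.form v) ↔
     ((∀ i, (P.transpose * q.M * P) i i = p.M i i) ∧
  ∀ i j, (P.transpose * q.M * P) i j + (P.transpose * q.M * P) j i = p.M i j + p.M j i) := by
    intro P
    rw [← quad_eq]
    refine forall_congr' fun v => ?_
    rw [form_apply', form_apply']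
    have : P.mulVec v ⬝ᵥ q.M.mulVec (P.mulVec v) = v ⬝ᵥ (P.transpose * q.M * P).mulVec v := by
      rw [← Matrix.mulVec_mulVec, ← Matrix.mulVec_mulVec, Matrix.dotProduct_mulVec v, Matrix.vecMul_transpose]
    rw [this]
  constructor
  · rintro ⟨e⟩
    refine ⟨LinearMap.toMatrix' e.toLinearEquiv.toLinearMap, LinearMap.toMatrix' e.toLinearEquiv.symm.toLinearMap, ?_, ?_, ?_⟩
    · rw [← LinearMap.toMatrix'_comp, LinearEquiv.comp_symm, LinearMap.toMatrix'_id]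
    · rw [← LinearMap.toMatrix'_comp, LinearEquiv.symm_comp, LinearMap.toMatrix'_id]
    · rw [← conv]
      intro v
      rw [LinearMap.toMatrix'_mulVec]
      exact e.map_app v
  · rintro ⟨P, P', h1, h2, h3⟩
    rw [← conv] at h3
    exact ⟨⟨Matrix.toLin'OfInv h2 h1, fun v => h3 v⟩⟩

end QF
end BL

namespace BL
namespace QF
variable {F : Type} [Field F]

open Matrix

/-- second coefficient -/
def s2 {n : ℕ} (X : Matrix (Fin n) (Fin n) F) : F :=
  ∑ i, ∑ j, if i < j then X i i * X j j - X i j * X j i else 0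

lemma sum_lt {n : ℕ} (f : Fin n → Fin n → F) (h : ∀ i, f i i = 0) :
    ∑ i, ∑ j, f i j = ∑ i, ∑ j, if i < j then f i j + f j i else 0 := by
  have e2 : ∀ i j, f i j = (if i < j then f i j else 0) + (if j < i then f i j else 0) := by
    intro i j
    rcases lt_trichotomy i j with h' | h' | h'
    · simp [h', h'.le]
    · simp [h', h]
    · simp [h', h'.le]
  rw [Finset.sum_congr rfl fun i _ => Finset.sum_congr rfl fun j _ => e2 i j]
  simp only [Finset.sum_add_distrib]
  rw [Finset.sum_comm (f := fun i j => if j < i then f i j else 0), ← Finset.sum_add_distrib]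
  refine Finset.sum_congr rfl fun i _ => ?_
  rw [← Finset.sum_add_distrib]
  refine Finset.sum_congr rfl fun j _ => ?_
  split_ifs <;> ring

lemma s2_add {n : ℕ} (X Y : Matrix (Fin n) (Fin n) F) :
    s2 (X + Y) = s2 X + s2 Y + X.trace * Y.trace - (X * Y).trace := by
  have : X.trace * Y.trace - (X * Y).trace = ∑ i, ∑ j, (X i i * Y j j - X i j * Y j i) := by
    simp only [Matrix.trace, Matrix.diag, Matrix.mul_apply, Finset.sum_sub_distrib, Finset.sum_mul_sum]
  rw [add_sub_assoc, this, sum_lt _ (fun i => by ring)]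
  simp only [s2, ← Finset.sum_add_distrib]
  refine Finset.sum_congr rfl fun i _ => Finset.sum_congr rfl fun j _ => ?_
  split_ifs
  · simp only [Matrix.add_apply]; ring
  · ring

lemma s2_mul {n m : ℕ} (P : Matrix (Fin n) (Fin m) F) (Q : Matrix (Fin m) (Fin n) F) :
    s2 (P * Q) = ∑ i, ∑ j, ∑ k, ∑ l, if i < j then if k < l then
      (P i k * P j l - P i l * P j k) * (Q k i * Q l j - Q l i * Q k j) else 0 else 0 := by
  unfold s2
  refine Finset.sum_congr rfl fun i _ => Finset.sum_congr rfl fun j _ => ?_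
  split_ifs with h
  · have : (P * Q) i i * (P * Q) j j - (P * Q) i j * (P * Q) j i =
        ∑ k, ∑ l, P i k * P j l * (Q k i * Q l j - Q l i * Q k j) := by
      simp only [Matrix.mul_apply, Finset.sum_mul_sum, ← Finset.sum_sub_distrib]
      refine Finset.sum_congr rfl fun k _ => Finset.sum_congr rfl fun l _ => ?_
      ring
    rw [this, sum_lt _ (fun i => by ring)]
    refine Finset.sum_congr rfl fun k _ => Finset.sum_congr rfl fun l _ => ?_
    split_ifs <;> ring
  · simp

lemma s2_comm {n m : ℕ} (P : Matrix (Fin n) (Fin m) F) (Q : Matrix (Fin m) (Fin n) F) :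
    s2 (P * Q) = s2 (Q * P) := by
  rw [s2_mul, s2_mul]
  have sw : ∀ f : Fin n → Fin n → Fin m → Fin m → F,
      ∑ i, ∑ j, ∑ k, ∑ l, f i j k l = ∑ k, ∑ l, ∑ i, ∑ j, f i j k l := by
    intro f
    have : ∀ i, ∑ j, ∑ k, ∑ l, f i j k l = ∑ k, ∑ l, ∑ j, f i j k l := by
      intro i
      rw [Finset.sum_comm]
      exact Finset.sum_congr rfl fun k _ => Finset.sum_comm
    simp_rw [this]
    rw [Finset.sum_comm]
    exact Finset.sum_congr rfl fun k _ => Finset.sum_comm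
  rw [sw]
  refine Finset.sum_congr rfl fun k _ => Finset.sum_congr rfl fun l _ =>
    Finset.sum_congr rfl fun i _ => Finset.sum_congr rfl fun j _ => ?_
  split_ifs <;> ring

lemma s2_transpose {n : ℕ} (X : Matrix (Fin n) (Fin n) F) : s2 Xᵀ = s2 X := by
  unfold s2
  refine Finset.sum_congr rfl fun i _ => Finset.sum_congr rfl fun j _ => ?_
  simp only [Matrix.transpose_apply]
  split_ifs <;> ring

section char2
variable [CharP F 2]

lemma tr_alt {n : ℕ} (M E : Matrix (Fin n) (Fin n) F) : ((M + Mᵀ) * (E + Eᵀ)).trace = 0 := by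
  have h1 : (Mᵀ * Eᵀ).trace = (M * E).trace := by
    rw [← Matrix.transpose_mul, Matrix.trace_transpose, Matrix.trace_mul_comm]
  have h2 : (M * Eᵀ).trace = (Mᵀ * E).trace := by
    rw [← Matrix.trace_transpose, Matrix.transpose_mul, Matrix.transpose_transpose, Matrix.trace_mul_comm]
  simp only [add_mul, mul_add, Matrix.trace_add, h1, h2]
  have := CharTwo.add_self_eq_zero ((M * E).trace)
  have := CharTwo.add_self_eq_zero ((Mᵀ * E).trace)
  linear_combination CharTwo.add_self_eq_zero ((M * E).trace) + CharTwo.add_self_eq_zero ((Mᵀ * E).trace)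

lemma s2_change {n : ℕ} (M C : Matrix (Fin n) (Fin n) F) (h : (M + Mᵀ) * (M + Mᵀ) = 1) :
    s2 ((M + Mᵀ) * M + (M + Mᵀ) * (C + Cᵀ)) = s2 ((M + Mᵀ) * M) +
      (((M + Mᵀ) * C).trace ^ 2 + ((M + Mᵀ) * C).trace) := by
  have a1 := s2_add ((M + Mᵀ) * M) ((M + Mᵀ) * (C + Cᵀ))
  have a2 := s2_add ((M + Mᵀ) * C) ((M + Mᵀ) * Cᵀ)
  have a3 := tr_alt M C
  have a4 := tr_alt M (C * M * Cᵀ)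
  have hB : (M + Mᵀ)ᵀ = M + Mᵀ := by simp [add_comm]
  have a5 : s2 ((M + Mᵀ) * Cᵀ) = s2 ((M + Mᵀ) * C) := by
    rw [s2_comm, ← s2_transpose]
    simp [hB]
  have a6 : ((M + Mᵀ) * Cᵀ).trace = ((M + Mᵀ) * C).trace := by
    rw [Matrix.trace_mul_comm, ← Matrix.trace_transpose]
    simp [hB]
  have a7 : C * M * Cᵀ + (C * M * Cᵀ)ᵀ = C * (M + Mᵀ) * Cᵀ := by
    simp [mul_add, add_mul, Matrix.mul_assoc]
  have a8 : ((M + Mᵀ) * M * ((M + Mᵀ) * (C + Cᵀ))).trace = ((M + Mᵀ) * C).trace := by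
    have : ((M + Mᵀ) * M * ((M + Mᵀ) * Cᵀ)).trace = ((M + Mᵀ) * Mᵀ * ((M + Mᵀ) * C)).trace := by
      rw [← Matrix.trace_transpose]
      simp only [Matrix.transpose_mul, hB, Matrix.transpose_transpose]
      rw [Matrix.mul_assoc, Matrix.trace_mul_comm]
      simp only [Matrix.mul_assoc]
    rw [mul_add, mul_add, Matrix.trace_add, this, ← Matrix.trace_add, ← add_mul, ← mul_add, h, one_mul]
  rw [a7] at a4
  have a9 : (M + Mᵀ) * (C * (M + Mᵀ) * Cᵀ) = (M + Mᵀ) * C * ((M + Mᵀ) * Cᵀ) := by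
    simp only [Matrix.mul_assoc]
  rw [a9] at a4
  rw [a1, a3, a8, mul_add, a2, a4, a5, a6]
  generalize ((M + Mᵀ) * C).trace = t
  generalize s2 ((M + Mᵀ) * C) = u
  linear_combination CharTwo.add_self_eq_zero u - CharTwo.add_self_eq_zero t

lemma arf_matrix {n m : ℕ} (M : Matrix (Fin n) (Fin n) F) (M' : Matrix (Fin m) (Fin m) F)
    (P : Matrix (Fin m) (Fin n) F) (P' : Matrix (Fin n) (Fin m) F) (h1 : P * P' = 1) (h2 : P' * P = 1)
    (hd : ∀ i, (Pᵀ * M' * P) i i = M i i)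
    (ho : ∀ i j, (Pᵀ * M' * P) i j + (Pᵀ * M' * P) j i = M i j + M j i)
    (hB : (M + Mᵀ) * (M + Mᵀ) = 1) (hB' : (M' + M'ᵀ) * (M' + M'ᵀ) = 1) :
    ∃ t : F, s2 ((M' + M'ᵀ) * M') = s2 ((M + Mᵀ) * M) + (t ^ 2 + t) := by
  obtain ⟨C, hC⟩ : ∃ C : Matrix (Fin n) (Fin n) F, ∀ i j, C i j = if i < j then (Pᵀ * M' * P) i j + M i j else 0 :=
    ⟨Matrix.of fun i j => if i < j then (Pᵀ * M' * P) i j + M i j else 0, fun i j => rfl⟩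
  refine ⟨((M + Mᵀ) * C).trace, ?_⟩
  rw [← s2_change M C hB]
  have e1 : C + Cᵀ = Pᵀ * M' * P + M := by
    ext i j
    simp only [Matrix.add_apply, Matrix.transpose_apply, hC]
    have := ho i j
    rcases lt_trichotomy i j with h | h | h
    · simp [h, h.le]
    · subst h
      simp [hd, CharTwo.add_self_eq_zero]
    · simp only [h, h.not_gt, if_true, if_false]
      linear_combination ho j i + CharTwo.add_self_eq_zero (M j i) -
        CharTwo.add_self_eq_zero ((Pᵀ * M' * P) i j)
  have e2 : M + Mᵀ = Pᵀ * (M' + M'ᵀ) * P := by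
    have e0 : Pᵀ * (M' + M'ᵀ) * P = Pᵀ * M' * P + (Pᵀ * M' * P)ᵀ := by
      simp [Matrix.mul_assoc, Matrix.mul_add, Matrix.add_mul]
    rw [e0]
    ext i j
    exact (ho i j).symm
  have e3 : (M + Mᵀ) * M + (M + Mᵀ) * (C + Cᵀ) = (M + Mᵀ) * (Pᵀ * M' * P) := by
    rw [e1, ← mul_add]
    congr 1
    ext i j
    simp only [Matrix.add_apply]
    linear_combination CharTwo.add_self_eq_zero (M i j)
  have h1t : P'ᵀ * Pᵀ = 1 := by rw [← Matrix.transpose_mul, h1, Matrix.transpose_one]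
  have e4 : (M + Mᵀ) * (P' * (M' + M'ᵀ) * P'ᵀ) = 1 := by
    rw [e2]
    calc Pᵀ * (M' + M'ᵀ) * P * (P' * (M' + M'ᵀ) * P'ᵀ) =
        Pᵀ * ((M' + M'ᵀ) * (P * P') * (M' + M'ᵀ)) * P'ᵀ := by simp only [Matrix.mul_assoc]
      _ = 1 := by
        rw [h1, Matrix.mul_one, hB', Matrix.mul_one, ← Matrix.transpose_mul, h2, Matrix.transpose_one]
  have e5 : M + Mᵀ = P' * (M' + M'ᵀ) * P'ᵀ := by
    calc M + Mᵀ = (M + Mᵀ) * ((M + Mᵀ) * (P' * (M' + M'ᵀ) * P'ᵀ)) := by rw [e4, Matrix.mul_one]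
      _ = _ := by rw [← Matrix.mul_assoc, hB, Matrix.one_mul]
  rw [e3, e5]
  have e6 : P' * (M' + M'ᵀ) * P'ᵀ * (Pᵀ * M' * P) = P' * ((M' + M'ᵀ) * M' * P) := by
    calc P' * (M' + M'ᵀ) * P'ᵀ * (Pᵀ * M' * P) = P' * (M' + M'ᵀ) * (P'ᵀ * Pᵀ) * M' * P := by
          simp only [Matrix.mul_assoc]
      _ = _ := by rw [h1t, Matrix.mul_one]; simp only [Matrix.mul_assoc]
  rw [e6, s2_comm P', Matrix.mul_assoc _ P, h1, Matrix.mul_one]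

/-- Arf data -/
def ArfData (q : QF F) (m : ℕ) (d : F) : Prop :=
  q.n = 2 * m ∧ (q.M + q.Mᵀ) * (q.M + q.Mᵀ) = 1 ∧ ((q.M + q.Mᵀ) * q.M).trace = m ∧
    s2 ((q.M + q.Mᵀ) * q.M) = d + (m.choose 2 : ℕ)

lemma arf_isom {p q : QF F} {m m' : ℕ} {d d' : F} (hp : ArfData p m d) (hq : ArfData q m' d')
    (h : Isom p q) : ∃ t : F, d + d' = t ^ 2 + t := by
  have hm : m = m' := by
    have := h.dim
    have := hp.1
    have := hq.1
    omega
  subst hm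
  obtain ⟨P, P', h1, h2, h3, h4⟩ := (isom_iff p q).1 h
  obtain ⟨t, ht⟩ := arf_matrix p.M q.M P P' h1 h2 h3 h4 hp.2.1 hq.2.1
  rw [hp.2.2.2, hq.2.2.2] at ht
  exact ⟨t, by linear_combination ht + CharTwo.add_self_eq_zero d⟩

lemma choose_two_add (m m' : ℕ) : (m + m').choose 2 = m.choose 2 + m'.choose 2 + m * m' := by
  rw [Nat.add_choose_eq]
  simp [Finset.Nat.antidiagonal_succ]
  ring

lemma s2_block (k l : ℕ) (X : Matrix (Fin k) (Fin k) F) (Y : Matrix (Fin l) (Fin l) F) :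
    s2 (Matrix.reindex finSumFinEquiv finSumFinEquiv (Matrix.fromBlocks X 0 0 Y)) =
      s2 X + s2 Y + X.trace * Y.trace := by
  unfold s2
  simp only [Fin.sum_univ_add, Matrix.reindex_apply, Matrix.submatrix_apply,
    finSumFinEquiv_symm_apply_castAdd, finSumFinEquiv_symm_apply_natAdd, Matrix.fromBlocks_apply₁₁,
    Matrix.fromBlocks_apply₁₂, Matrix.fromBlocks_apply₂₁, Matrix.fromBlocks_apply₂₂]
  have l1 : ∀ i j : Fin k, (Fin.castAdd l i < Fin.castAdd l j) = (i < j) := fun i j => rfl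
  have l2 : ∀ i j : Fin l, (Fin.natAdd k i < Fin.natAdd k j) = (i < j) := fun i j => by simp
  have l3 : ∀ (i : Fin k) (j : Fin l), (Fin.castAdd l i < Fin.natAdd k j) = True := fun i j => by
    rw [Fin.lt_def]; simp; omega
  have l4 : ∀ (i : Fin k) (j : Fin l), (Fin.natAdd k j < Fin.castAdd l i) = False := fun i j => by
    rw [Fin.lt_def]; simp; omega
  simp only [l1, l2, l3, l4, if_true, if_false, Matrix.zero_apply, mul_zero, sub_zero]
  simp only [Finset.sum_add_distrib, Matrix.trace, Matrix.diag, Finset.sum_mul_sum, Finset.sum_const_zero]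
  ring

lemma arf_oplus {p q : QF F} {m m' : ℕ} {d d' : F} (hp : ArfData p m d) (hq : ArfData q m' d') :
    ArfData (oplus p q) (m + m') (d + d') := by
  obtain ⟨k, M⟩ := p
  obtain ⟨l, N⟩ := q
  obtain ⟨p1, p2, p3, p4⟩ := hp
  obtain ⟨q1, q2, q3, q4⟩ := hq
  dsimp only at p1 p2 p3 p4 q1 q2 q3 q4
  obtain ⟨R, hR⟩ : ∃ R, R = Matrix.reindex finSumFinEquiv finSumFinEquiv (Matrix.fromBlocks M 0 0 N) := ⟨_, rfl⟩
  have eB : R + Rᵀ = Matrix.reindex finSumFinEquiv finSumFinEquiv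
      (Matrix.fromBlocks (M + Mᵀ) 0 0 (N + Nᵀ)) := by
    rw [hR]
    simp only [Matrix.reindex_apply, Matrix.transpose_submatrix, Matrix.fromBlocks_transpose,
      Matrix.transpose_zero]
    have := congrFun (congrFun (Matrix.submatrix_add (fromBlocks M 0 0 N) (fromBlocks Mᵀ 0 0 Nᵀ))
      (finSumFinEquiv.symm : Fin (k + l) → _)) (finSumFinEquiv.symm : Fin (k + l) → _)
    refine this.symm.trans ?_
    simp [Matrix.fromBlocks_add]
  have eX : (R + Rᵀ) * R = Matrix.reindex finSumFinEquiv finSumFinEquiv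
      (Matrix.fromBlocks ((M + Mᵀ) * M) 0 0 ((N + Nᵀ) * N)) := by
    rw [eB, hR]
    simp only [Matrix.reindex_apply]
    rw [Matrix.submatrix_mul_equiv]
    simp [Matrix.fromBlocks_multiply]
  have key : k + l = 2 * (m + m') ∧ (R + Rᵀ) * (R + Rᵀ) = 1 ∧ ((R + Rᵀ) * R).trace = ((m + m' : ℕ) : F) ∧
      s2 ((R + Rᵀ) * R) = d + d' + ((m + m').choose 2 : ℕ) := by
    refine ⟨by omega, ?_, ?_, ?_⟩
    · rw [eB]
      simp only [Matrix.reindex_apply]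
      rw [Matrix.submatrix_mul_equiv, Matrix.fromBlocks_multiply]
      simp [p2, q2]
    · rw [eX]
      push_cast
      rw [← p3, ← q3]
      simp [Matrix.trace, Fin.sum_univ_add]
    · rw [eX, s2_block, p3, p4, q3, q4, choose_two_add]
      push_cast
      ring
  rw [hR] at key
  exact key

lemma arf_bin (a b : F) : ArfData (bin a b) 1 (a * b) := by
  have h2 : ∀ x : F, x + x = 0 := CharTwo.add_self_eq_zero
  refine ⟨rfl, ?_, ?_, ?_⟩
  · show (!![a, 1; 0, b] + !![a, 1; 0, b]ᵀ) * (!![a, 1; 0, b] + !![a, 1; 0, b]ᵀ) = (1 : Matrix (Fin 2) (Fin 2) F)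
    ext i j
    fin_cases i <;> fin_cases j <;> simp [Matrix.mul_apply, Fin.sum_univ_two, h2]
  · show ((!![a, 1; 0, b] + !![a, 1; 0, b]ᵀ) * !![a, 1; 0, b]).trace = _
    simp [Matrix.trace, Matrix.mul_apply, Fin.sum_univ_two, h2]
  · show s2 ((!![a, 1; 0, b] + !![a, 1; 0, b]ᵀ) * !![a, 1; 0, b]) = _
    simp [s2, Matrix.mul_apply, Fin.sum_univ_two, h2]
    linear_combination - h2 (a * b)

lemma arf_PL (L : List (F × F)) : ArfData (PL L) L.length (L.map fun t => t.1 * t.2).sum := by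
  induction L with
  | nil =>
    refine ⟨rfl, ?_, ?_, ?_⟩
    · ext i; exact Fin.elim0 i
    · simp [Matrix.trace]; rfl
    · simp [s2]; rfl
  | cons a L ih =>
    have := arf_oplus (arf_bin a.1 a.2) ih
    rw [add_comm] at this
    rw [List.length_cons, List.map_cons, List.sum_cons]
    exact this

end char2
end QF
end BL

namespace BL
namespace QF
variable {F : Type} [Field F]

open Matrix

/-- trivial radical -/
def RT {V : Type} [AddCommGroup V] [Module F V] (Q : QuadraticForm F V) : Prop :=
  ∀ v, (∀ w, QuadraticMap.polar Q v w = 0) → v = 0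

/-- anisotropic radical -/
def RA {V : Type} [AddCommGroup V] [Module F V] (Q : QuadraticForm F V) : Prop :=
  ∀ v, (∀ w, QuadraticMap.polar Q v w = 0) → Q v = 0 → v = 0

section
variable {V W : Type} [AddCommGroup V] [Module F V] [AddCommGroup W] [Module F W]
  {Q : QuadraticForm F V} {R : QuadraticForm F W}

lemma RT.equiv (h : RT Q) (e : Q.Equivalent R) : RT R := by
  obtain ⟨e⟩ := e
  intro v hv
  have : e.symm v = 0 := by
    refine h _ fun w => ?_
    have := hv (e w)
    rw [← this]
    simp only [QuadraticMap.polar]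
    rw [← e.map_app, ← e.map_app (e.symm v), ← e.map_app w, map_add, e.apply_symm_apply]
  simpa using this

lemma RA.equiv (h : RA Q) (e : Q.Equivalent R) : RA R := by
  obtain ⟨e⟩ := e
  intro v hv hv'
  have : e.symm v = 0 := by
    refine h _ (fun w => ?_) ?_
    · have := hv (e w)
      rw [← this]
      simp only [QuadraticMap.polar]
      rw [← e.map_app, ← e.map_app (e.symm v), ← e.map_app w, map_add, e.apply_symm_apply]
    · rw [← e.map_app, e.apply_symm_apply, hv']
  simpa using this

lemma aniso_equiv (h : Q.Anisotropic) (e : Q.Equivalent R) : R.Anisotropic := by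
  obtain ⟨e⟩ := e
  intro v hv
  have : e.symm v = 0 := h _ (by rw [← e.map_app, e.apply_symm_apply, hv])
  simpa using this

lemma RT.left (h : RT (Q.prod R)) : RT Q := by
  intro v hv
  have := h (v, 0) (by
    rintro ⟨a, b⟩
    have := hv a
    simp only [QuadraticMap.polar, QuadraticMap.prod_apply, Prod.mk_add_mk, zero_add, map_zero] at this ⊢
    linear_combination this)
  simpa using this

lemma RT.right (h : RT (Q.prod R)) : RT R := by
  intro v hv
  have := h (0, v) (by
    rintro ⟨a, b⟩
    have := hv b
    simp only [QuadraticMap.polar, QuadraticMap.prod_apply, Prod.mk_add_mk, zero_add, map_zero] at this ⊢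
    linear_combination this)
  simpa using this

lemma RA.left (h : RA (Q.prod R)) : RA Q := by
  intro v hv hv'
  have := h (v, 0) (by
    rintro ⟨a, b⟩
    have := hv a
    simp only [QuadraticMap.polar, QuadraticMap.prod_apply, Prod.mk_add_mk, zero_add, map_zero] at this ⊢
    linear_combination this) (by simpa using hv')
  simpa using this

lemma RA.right (h : RA (Q.prod R)) : RA R := by
  intro v hv hv'
  have := h (0, v) (by
    rintro ⟨a, b⟩
    have := hv b
    simp only [QuadraticMap.polar, QuadraticMap.prod_apply, Prod.mk_add_mk, zero_add, map_zero] at this ⊢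
    linear_combination this) (by simpa using hv')
  simpa using this

lemma RA.prod (h : Q.Anisotropic) (h' : RT R) : RA (Q.prod R) := by
  rintro ⟨v, w⟩ hv hv'
  have hw : w = 0 := h' w fun b => by simpa [QuadraticMap.polar] using hv (0, b)
  subst hw
  have : v = 0 := h v (by simpa using hv')
  simp [this]

end

lemma polar_form (q : QF F) (v w : Fin q.n → F) :
    QuadraticMap.polar q.form v w = w ⬝ᵥ (q.M + q.Mᵀ).mulVec v := by
  have : w ⬝ᵥ (q.Mᵀ).mulVec v = v ⬝ᵥ q.M.mulVec w := by
    rw [Matrix.dotProduct_mulVec, Matrix.vecMul_transpose, dotProduct_comm]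
  rw [Matrix.add_mulVec, dotProduct_add, this]
  simp only [QuadraticMap.polar, form_apply', Matrix.mulVec_add, dotProduct_add, add_dotProduct]
  ring

lemma RT_iff (q : QF F) : RT q.form ↔ (q.M + q.Mᵀ).det ≠ 0 := by
  rw [Ne, ← Matrix.exists_mulVec_eq_zero_iff]
  push Not
  constructor
  · intro h v hv hz
    exact hv (h v fun w => by rw [polar_form, hz, dotProduct_zero])
  · intro h v hv
    by_contra hne
    refine h v hne ?_
    ext i
    have := hv (Pi.single i 1)
    rw [polar_form] at this
    simpa using this

lemma RT_oplus_left {p q : QF F} (h : RT (oplus p q).form) : RT p.form :=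
  (h.equiv (oplus_equiv p q).symm).left
lemma RT_oplus_right {p q : QF F} (h : RT (oplus p q).form) : RT q.form :=
  (h.equiv (oplus_equiv p q).symm).right
lemma RA_oplus_left {p q : QF F} (h : RA (oplus p q).form) : RA p.form :=
  (h.equiv (oplus_equiv p q).symm).left
lemma RA_oplus_right {p q : QF F} (h : RA (oplus p q).form) : RA q.form :=
  (h.equiv (oplus_equiv p q).symm).right

lemma RT_zeroN {j : ℕ} (h : RT (zeroN j : QF F).form) : j = 0 := by
  rw [RT_iff] at h
  by_contra hj
  apply h
  show ((0 : Matrix (Fin j) (Fin j) F) + 0ᵀ).det = 0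
  have : Nonempty (Fin j) := ⟨⟨0, Nat.pos_of_ne_zero hj⟩⟩
  simp

lemma RT_PL [CharP F 2] (L : List (F × F)) : RT (PL L).form := by
  rw [RT_iff]
  intro h
  have := congrArg Matrix.det (arf_PL L).2.1
  rw [Matrix.det_mul, h] at this
  simp at this

lemma RA_sm_ne {c : F} {q : QF F} (hq : q.n ≠ 0) (h : RA (sm c q).form) : c ≠ 0 := by
  rintro rfl
  have hf : ∀ v, (sm 0 q).form v = 0 := by
    intro v
    refine (form_apply _ v).trans ?_
    show ∑ i : Fin q.n, ∑ j : Fin q.n, v i * ((0 : F) • q.M) i j * v j = 0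
    rw [zero_smul]
    simp
  have := h (fun _ => 1) (fun w => by simp [QuadraticMap.polar, hf]) (hf _)
  have := congrFun this (⟨0, Nat.pos_of_ne_zero hq⟩ : Fin q.n)
  exact one_ne_zero this

lemma sm_oplus (c : F) (p q : QF F) : sm c (oplus p q) = oplus (sm c p) (sm c q) := by
  have : c • (fromBlocks p.M 0 0 q.M) = fromBlocks (c • p.M) 0 0 (c • q.M) := by
    simp [Matrix.fromBlocks_smul]
  have h2 : c • (Matrix.reindex finSumFinEquiv finSumFinEquiv (fromBlocks p.M 0 0 q.M)) =
      Matrix.reindex finSumFinEquiv finSumFinEquiv (fromBlocks (c • p.M) 0 0 (c • q.M)) := by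
    rw [← this]
    rfl
  exact congrArg (QF.mk (p.n + q.n)) h2

lemma sm_sm (c a : F) (q : QF F) : sm c (sm a q) = sm (c * a) q := by
  exact congrArg (QF.mk q.n) (smul_smul c a q.M)

lemma mk_isom {n m : ℕ} {M : Matrix (Fin n) (Fin n) F} {N : Matrix (Fin m) (Fin m) F}
    (P : Matrix (Fin m) (Fin n) F) (P' : Matrix (Fin n) (Fin m) F)
    (h1 : P * P' = 1) (h2 : P' * P = 1)
    (h3 : ∀ i, (P.transpose * N * P) i i = M i i)
    (h4 : ∀ i j, (P.transpose * N * P) i j + (P.transpose * N * P) j i = M i j + M j i) :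
    Isom ⟨n, M⟩ ⟨m, N⟩ := (isom_iff _ _).2 ⟨P, P', h1, h2, h3, h4⟩

lemma isom_sm {c : F} (hc : c ≠ 0) (b : F) : Isom (sm c (bin 1 b)) (bin c (b / c)) := by
  refine mk_isom (n := 2) (m := 2) (M := c • !![1, 1; 0, b]) (N := !![c, 1; 0, b / c]) !![1, 0; 0, c] !![1, 0; 0, c⁻¹] ?_ ?_ ?_ ?_
  · ext i j; fin_cases i <;> fin_cases j <;> simp [hc]
  · ext i j; fin_cases i <;> fin_cases j <;> simp [hc]
  · intro i; fin_cases i <;> simp [Matrix.mul_apply, Fin.sum_univ_two]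
    field_simp
  · intro i j; fin_cases i <;> fin_cases j <;> simp [Matrix.mul_apply, Fin.sum_univ_two]
    field_simp

lemma isom_0y (y : F) : Isom (bin 0 y) (bin 0 0) := by
  refine mk_isom (n := 2) (m := 2) !![1, y; 0, 1] !![1, -y; 0, 1] ?_ ?_ ?_ ?_
  · ext i j; fin_cases i <;> fin_cases j <;> simp
  · ext i j; fin_cases i <;> fin_cases j <;> simp
  · intro i; fin_cases i <;> simp [Matrix.mul_apply, Fin.sum_univ_two]
  · intro i j; fin_cases i <;> fin_cases j <;> simp [Matrix.mul_apply, Fin.sum_univ_two]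

lemma isom_10 : Isom (bin 1 (0 : F)) (bin 0 0) := by
  refine mk_isom (n := 2) (m := 2) !![1, 0; 1, 1] !![1, 0; -1, 1] ?_ ?_ ?_ ?_
  · ext i j; fin_cases i <;> fin_cases j <;> simp
  · ext i j; fin_cases i <;> fin_cases j <;> simp
  · intro i; fin_cases i <;> simp [Matrix.mul_apply, Fin.sum_univ_two]
  · intro i j; fin_cases i <;> fin_cases j <;> simp [Matrix.mul_apply, Fin.sum_univ_two]

lemma isom_shift [CharP F 2] {a b c t : F} (ha : a ≠ 0) (hc : a * c = t ^ 2 + t) :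
    Isom (bin a (b + c)) (bin a b) := by
  have h2 : ∀ x : F, x + x = 0 := CharTwo.add_self_eq_zero
  have hc' : c = (t ^ 2 + t) / a := by field_simp; linear_combination hc
  subst hc'
  refine mk_isom (n := 2) (m := 2) !![1, t / a; 0, 1] !![1, - (t / a); 0, 1] ?_ ?_ ?_ ?_
  · ext i j; fin_cases i <;> fin_cases j <;> simp
  · ext i j; fin_cases i <;> fin_cases j <;> simp
  · intro i; fin_cases i <;> simp [Matrix.mul_apply, Fin.sum_univ_two]
    field_simp
    ring
  · intro i j; fin_cases i <;> fin_cases j <;> simp [Matrix.mul_apply, Fin.sum_univ_two] <;> field_simp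
    · linear_combination h2 t
    · linear_combination h2 t
    · ring

lemma bin_apply (a b : F) (v : Fin 2 → F) :
    (show QuadraticForm F (Fin 2 → F) from (bin a b).form) v = a * v 0 ^ 2 + v 0 * v 1 + b * v 1 ^ 2 := by
  refine (form_apply (bin a b) v).trans ?_
  show ∑ i : Fin 2, ∑ j : Fin 2, v i * (!![a, 1; 0, b] : Matrix (Fin 2) (Fin 2) F) i j * v j = _
  simp [Fin.sum_univ_two]
  ring

lemma isom_add [CharP F 2] (x y : F) :
    Isom (oplus (bin 1 (x + y)) (bin 0 y)) (oplus (bin 1 x) (bin 1 y)) := by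
  have h2 : ∀ x : F, x + x = 0 := CharTwo.add_self_eq_zero
  refine (oplus_equiv _ _).symm.trans (QuadraticMap.Equivalent.trans ?_ (oplus_equiv _ _))
  let e : ((Fin 2 → F) × (Fin 2 → F)) ≃ₗ[F] ((Fin 2 → F) × (Fin 2 → F)) :=
    { toFun := fun w => (![w.1 0 + w.2 0, w.1 1], ![w.2 0, w.1 1 + w.2 1])
      invFun := fun w => (![w.1 0 - w.2 0, w.1 1], ![w.2 0, w.2 1 - w.1 1])
      map_add' := by
        intro u v
        ext i <;> fin_cases i <;> simp <;> ring
      map_smul' := by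
        intro u v
        ext i <;> fin_cases i <;> simp <;> ring
      left_inv := by
        intro u
        ext i <;> fin_cases i <;> simp
      right_inv := by
        intro u
        ext i <;> fin_cases i <;> simp }
  refine ⟨⟨e, ?_⟩⟩
  intro w
  obtain ⟨u, v, rfl⟩ : ∃ u v : Fin 2 → F, w = (u, v) := ⟨w.1, w.2, rfl⟩
  refine (congrArg₂ (· + ·) (bin_apply 1 x _) (bin_apply 1 y _)).trans ?_
  refine Eq.trans ?_ (congrArg₂ (· + ·) (bin_apply 1 (x + y) u) (bin_apply 0 y v)).symm
  simp [e]
  linear_combination (u 0 * v 0 + v 0 * u 1) * h2 1 + v 0 ^ 2 * h2 1 + y * u 1 * v 1 * h2 1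

lemma exists_PL [CharP F 2] (n : ℕ) : ∀ (V : Type) [AddCommGroup V] [Module F V] [FiniteDimensional F V]
    (Q : QuadraticForm F V), Module.finrank F V ≤ n → RT Q → ∃ L, Q.Equivalent (PL L).form := by
  have h2 : ∀ x : F, x + x = 0 := CharTwo.add_self_eq_zero
  have base : ∀ (V : Type) [AddCommGroup V] [Module F V] [FiniteDimensional F V]
    (Q : QuadraticForm F V), Subsingleton V → ∃ L, Q.Equivalent (PL L).form := by
    intro V _ _ _ Q hs
    refine ⟨[], ?_⟩
    have : Subsingleton (Fin (PL ([] : List (F × F))).n → F) := by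
      show Subsingleton (Fin 0 → F)
      infer_instance
    refine ⟨⟨LinearEquiv.ofBijective 0 ⟨fun _ _ _ => Subsingleton.elim _ _, fun x => ⟨0, Subsingleton.elim _ _⟩⟩, ?_⟩⟩
    intro m
    have : m = 0 := Subsingleton.elim _ _
    subst this
    simp
  induction n with
  | zero =>
    intro V _ _ _ Q hn _
    exact base V Q (Module.finrank_zero_iff.1 (Nat.le_zero.1 hn))
  | succ n ih =>
    intro V _ _ _ Q hn hQ
    by_cases hs : Subsingleton V
    · exact base V Q hs
    rw [not_subsingleton_iff_nontrivial] at hs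
    obtain ⟨v, hv⟩ := exists_ne (0 : V)
    obtain ⟨w0, hw0⟩ : ∃ w, QuadraticMap.polar Q v w ≠ 0 := by
      by_contra hcon
      push Not at hcon
      exact hv (hQ v hcon)
    obtain ⟨w, hw⟩ : ∃ w, Q.polarBilin v w = 1 := by
      refine ⟨(QuadraticMap.polar Q v w0)⁻¹ • w0, ?_⟩
      rw [map_smul]
      simp [hw0]
    have hself : ∀ x, Q.polarBilin x x = 0 := by
      intro x
      rw [QuadraticMap.polarBilin_apply_apply, QuadraticMap.polar_self, two_smul]
      exact h2 _
    have hcomm : ∀ x y, Q.polarBilin x y = Q.polarBilin y x := by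
      intro x y
      simp [QuadraticMap.polar_comm]
    have hw' : Q.polarBilin w v = 1 := by rw [hcomm, hw]
    have hadd : ∀ x y, Q (x + y) = Q x + Q y + Q.polarBilin x y := by
      intro x y
      simp only [QuadraticMap.polarBilin_apply_apply, QuadraticMap.polar]
      ring
    let W : Submodule F V := LinearMap.ker (Q.polarBilin v) ⊓ LinearMap.ker (Q.polarBilin w)
    have hW : ∀ u : W, Q.polarBilin v u = 0 ∧ Q.polarBilin w u = 0 := fun u => u.2
    let e : ((Fin 2 → F) × W) ≃ₗ[F] V :=
      { toFun := fun z => z.1 0 • v + z.1 1 • w + z.2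
        invFun := fun z => (![Q.polarBilin w z, Q.polarBilin v z],
          ⟨z - (Q.polarBilin w z • v + Q.polarBilin v z • w), by
            show z - (Q.polarBilin w z • v + Q.polarBilin v z • w) ∈
              LinearMap.ker (Q.polarBilin v) ⊓ LinearMap.ker (Q.polarBilin w)
            simp only [Submodule.mem_inf, LinearMap.mem_ker, map_sub, map_add, map_smul, hself, hw, hw']
            simp⟩)
        map_add' := by
          intro x y
          simp [add_smul]
          abel
        map_smul' := by
          intro c x
          simp [mul_smul]
        left_inv := by
          rintro ⟨z, u⟩
          obtain ⟨hu1, hu2⟩ := hW u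
          have a1 : Q.polarBilin w (z 0 • v + z 1 • w + u) = z 0 := by
            simp only [map_add, map_smul, hself, hw', hu2]; simp
          have a2 : Q.polarBilin v (z 0 • v + z 1 • w + u) = z 1 := by
            simp only [map_add, map_smul, hself, hw, hu1]; simp
          simp only [a1, a2]
          ext i
          · fin_cases i <;> simp
          · simp
        right_inv := by
          intro z
          simp }
    have hE : ((show QuadraticForm F (Fin 2 → F) from (bin (Q v) (Q w)).form).prod (Q.comp W.subtype)).Equivalent Q := by
      refine ⟨⟨e, ?_⟩⟩
      rintro ⟨z, u⟩
      obtain ⟨hu1, hu2⟩ := hW u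
      refine Eq.trans ?_ (congrArg₂ (· + ·) (bin_apply (Q v) (Q w) z) rfl).symm
      show Q (z 0 • v + z 1 • w + u) = _ + Q u
      rw [hadd, hadd, QuadraticMap.map_smul, QuadraticMap.map_smul]
      simp only [map_add, map_smul, LinearMap.add_apply, LinearMap.smul_apply, hu1, hu2, hw, smul_eq_mul]
      ring
    have hR := hQ.equiv hE.symm
    have hfr := e.finrank_eq
    rw [Module.finrank_prod, Module.finrank_fin_fun] at hfr
    obtain ⟨L, hL⟩ := ih W (Q.comp W.subtype) (by omega) hR.right
    refine ⟨(Q v, Q w) :: L, hE.symm.trans ?_⟩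
    exact (QuadraticMap.Equivalent.prod (QuadraticMap.Equivalent.refl _) hL).trans (oplus_equiv (bin (Q v) (Q w)) (PL L))

end QF
end BL

namespace BL
namespace QF
variable {F : Type} [Field F]

open Matrix

section bc
variable {K : Type} [Field K] [Algebra F K]

lemma bc_isom {p q : QF F} (h : Isom p q) : Isom (p.bc K) (q.bc K) := by
  obtain ⟨P, P', h1, h2, h3, h4⟩ := (isom_iff p q).1 h
  have e : (P.map (algebraMap F K))ᵀ * q.M.map (algebraMap F K) * P.map (algebraMap F K) =
      (Pᵀ * q.M * P).map (algebraMap F K) := by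
    rw [Matrix.map_mul, Matrix.map_mul, Matrix.transpose_map]
  refine mk_isom (n := p.n) (m := q.n) (P.map (algebraMap F K)) (P'.map (algebraMap F K)) ?_ ?_ ?_ ?_
  · rw [← Matrix.map_mul, h1]; simp
  · rw [← Matrix.map_mul, h2]; simp
  · intro i
    show ((P.map (algebraMap F K))ᵀ * q.M.map (algebraMap F K) * P.map (algebraMap F K)) i i =
      (p.M.map (algebraMap F K)) i i
    rw [e, Matrix.map_apply, h3, Matrix.map_apply]
  · intro i j
    show ((P.map (algebraMap F K))ᵀ * q.M.map (algebraMap F K) * P.map (algebraMap F K)) i j +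
      ((P.map (algebraMap F K))ᵀ * q.M.map (algebraMap F K) * P.map (algebraMap F K)) j i =
      (p.M.map (algebraMap F K)) i j + (p.M.map (algebraMap F K)) j i
    rw [e, Matrix.map_apply, Matrix.map_apply, ← map_add, h4, map_add, Matrix.map_apply, Matrix.map_apply]

lemma bc_oplus (p q : QF F) : (oplus p q).bc K = oplus (p.bc K) (q.bc K) := by
  have h2 : (Matrix.reindex finSumFinEquiv finSumFinEquiv (fromBlocks p.M 0 0 q.M)).map (algebraMap F K) =
      Matrix.reindex finSumFinEquiv finSumFinEquiv
        (fromBlocks (p.M.map (algebraMap F K)) 0 0 (q.M.map (algebraMap F K))) := by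
    have := Matrix.fromBlocks_map p.M 0 0 q.M (algebraMap F K)
    rw [Matrix.map_zero _ (map_zero _), Matrix.map_zero _ (map_zero _)] at this
    rw [← this]
    rfl
  exact congrArg (QF.mk (p.n + q.n)) h2

lemma bc_bin (a b : F) : (bin a b).bc K = bin (algebraMap F K a) (algebraMap F K b) := by
  refine congrArg (QF.mk 2) ?_
  show (!![a, 1; 0, b] : Matrix (Fin 2) (Fin 2) F).map (algebraMap F K) = _
  ext i j
  fin_cases i <;> fin_cases j <;> simp

lemma bc_nil : (nil : QF F).bc K = nil := by
  refine congrArg (QF.mk 0) ?_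
  ext i
  exact Fin.elim0 i

/-- map on lists -/
def mapL (K : Type) [Field K] [Algebra F K] (L : List (F × F)) : List (K × K) :=
  L.map fun t => (algebraMap F K t.1, algebraMap F K t.2)

lemma bc_PL (L : List (F × F)) : (PL L).bc K = PL (mapL K L) := by
  induction L with
  | nil => exact bc_nil
  | cons a L ih =>
    show (oplus (bin a.1 a.2) (PL L)).bc K = oplus (bin (algebraMap F K a.1) (algebraMap F K a.2)) (PL (mapL K L))
    rw [bc_oplus, bc_bin, ih]

lemma bc_hypN (k : ℕ) : (hypN k : QF F).bc K = hypN k := by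
  rw [hypN_eq, bc_PL, hypN_eq]
  simp [mapL]

lemma sum_mapL (L : List (F × F)) : ((mapL K L).map fun t => t.1 * t.2).sum =
    algebraMap F K (L.map fun t => t.1 * t.2).sum := by
  induction L with
  | nil => simp [mapL]
  | cons a L ih =>
    simp only [mapL, List.map_cons, List.sum_cons, map_add, map_mul] at ih ⊢
    rw [ih]

lemma RT_bc {q : QF F} (h : RT (q.bc K).form) : RT q.form := by
  rw [RT_iff] at h ⊢
  intro h0
  apply h
  show (q.M.map (algebraMap F K) + (q.M.map (algebraMap F K))ᵀ).det = 0
  have : q.M.map (algebraMap F K) + (q.M.map (algebraMap F K))ᵀ = (q.M + q.Mᵀ).map (algebraMap F K) := by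
    ext i j
    simp
  rw [this]
  have := (algebraMap F K).map_det (q.M + q.Mᵀ)
  rw [h0, map_zero] at this
  exact this.symm

end bc

variable [CharP F 2]

lemma qpf_planes {c a b : F} (h : RA (sm c (qpf [a] b)).form) : c ≠ 0 ∧ a ≠ 0 ∧
    cl (sm c (qpf [a] b)) = cl (PL [(c, b / c), (c * a, b / (c * a))]) := by
  have e : sm c (qpf [a] b) = oplus (sm c (bin 1 b)) (sm (c * a) (bin 1 b)) := by
    show sm c (oplus (bin 1 b) (sm a (bin 1 b))) = _
    rw [sm_oplus, sm_sm]
  rw [e] at h ⊢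
  have h1 : c ≠ 0 := RA_sm_ne (by show (2 : ℕ) ≠ 0; norm_num) (RA_oplus_left h)
  have h2 : c * a ≠ 0 := RA_sm_ne (by show (2 : ℕ) ≠ 0; norm_num) (RA_oplus_right h)
  refine ⟨h1, right_ne_zero_of_mul h2, ?_⟩
  rw [cl_oplus, cl_PL_cons, cl_PL_cons, cl_PL_nil, add_zero, cl_eq.2 (isom_sm h1 b), cl_eq.2 (isom_sm h2 b)]

lemma S_planes (L : List (F × List F × F)) (hL : ∀ t ∈ L, t.2.1.length + 1 = 2)
    (h : RA (sumList (L.map fun t => sm t.1 (qpf t.2.1 t.2.2))).form) :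
    ∃ T : List (F × F), cl (sumList (L.map fun t => sm t.1 (qpf t.2.1 t.2.2))) = cl (PL T) ∧
      (T.map fun t => t.1 * t.2).sum = 0 := by
  induction L with
  | nil => exact ⟨[], rfl, rfl⟩
  | cons t L ih =>
    obtain ⟨c, l, b⟩ := t
    have h0 : RA (oplus (sm c (qpf l b)) (sumList (L.map fun t => sm t.1 (qpf t.2.1 t.2.2)))).form := h
    obtain ⟨T, hT, hs⟩ := ih (fun t ht => hL t (List.mem_cons_of_mem _ ht)) (RA_oplus_right h0)
    have hl := hL (c, l, b) List.mem_cons_self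
    obtain ⟨a, rfl⟩ : ∃ a, l = [a] := List.length_eq_one_iff.1 (by simpa using hl)
    obtain ⟨h1, h2, h3⟩ := qpf_planes (RA_oplus_left h0)
    refine ⟨[(c, b / c), (c * a, b / (c * a))] ++ T, ?_, ?_⟩
    · rw [cl_PL_append, ← h3, ← hT]
      rfl
    · have e1 : c * (b / c) = b := by field_simp
      have e2 : c * a * (b / (c * a)) = b := by field_simp
      simp only [List.cons_append, List.nil_append, List.map_cons, List.sum_cons, hs, e1, e2]
      linear_combination CharTwo.add_self_eq_zero b

lemma cl_add (x y : F) : cl (bin 1 x) + cl (bin 1 y) = cl (bin 1 (x + y)) + cl (bin 0 0) := by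
  rw [← cl_oplus, ← cl_eq.2 (isom_add x y), cl_oplus, cl_eq.2 (isom_0y y)]

lemma PL_decomp (L : List (F × F)) : ∃ (T : List (F × List F × F)) (k l : ℕ),
    (∀ t ∈ T, t.2.1.length + 1 = 2) ∧
    cl (PL L) + k • cl (bin 0 0) = cl (sumList (T.map fun t => sm t.1 (qpf t.2.1 t.2.2))) +
      cl (bin 1 (L.map fun t => t.1 * t.2).sum) + l • cl (bin 0 0) := by
  induction L with
  | nil =>
    refine ⟨[], 1, 0, by simp, ?_⟩
    simp only [List.map_nil, List.sum_nil, cl_eq.2 isom_10, cl_PL_nil, one_smul, zero_smul]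
    show 0 + _ = 0 + _ + 0
    abel
  | cons t L ih =>
    obtain ⟨a, b⟩ := t
    obtain ⟨T, k, l, hT, e⟩ := ih
    by_cases ha : a = 0
    · subst ha
      refine ⟨T, k, l + 1, hT, ?_⟩
      simp only [List.map_cons, List.sum_cons, zero_mul, zero_add]
      rw [cl_PL_cons, cl_eq.2 (isom_0y b), add_assoc, e, add_smul, one_smul]
      abel
    · refine ⟨(1, [a], a * b) :: T, k + 2, l + 1, ?_, ?_⟩
      · intro t ht
        rcases List.mem_cons.1 ht with rfl | ht
        · rfl
        · exact hT t ht
      · simp only [List.map_cons, List.sum_cons]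
        have e1 : cl (sm 1 (qpf [a] (a * b))) = cl (bin 1 (a * b)) + cl (bin a b) := by
          have : sm 1 (qpf [a] (a * b)) = oplus (bin 1 (a * b)) (sm a (bin 1 (a * b))) := by
            exact congrArg (QF.mk _) (one_smul F _)
          rw [this, cl_oplus, cl_eq.2 (isom_sm ha _)]
          congr 3
          field_simp
        have e2 : cl (sumList (sm 1 (qpf [a] (a * b)) :: T.map fun t => sm t.1 (qpf t.2.1 t.2.2))) =
            cl (sm 1 (qpf [a] (a * b))) + cl (sumList (T.map fun t => sm t.1 (qpf t.2.1 t.2.2))) := rfl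
        have e3 := cl_add (a * b) (L.map fun t => t.1 * t.2).sum
        have e4 := cl_add (a * b) (a * b)
        rw [CharTwo.add_self_eq_zero, cl_eq.2 isom_10] at e4
        rw [e2, e1, cl_PL_cons, add_smul, add_smul, one_smul, two_smul]
        generalize cl (bin (0 : F) 0) = H at *
        generalize cl (bin 1 (a * b)) = A at *
        generalize cl (bin a b) = B at *
        generalize cl (sumList (T.map fun t => sm t.1 (qpf t.2.1 t.2.2))) = S at *
        generalize cl (bin 1 (L.map fun t => t.1 * t.2).sum) = D at *
        generalize cl (bin 1 (a * b + (L.map fun t => t.1 * t.2).sum)) = E at *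
        generalize cl (PL L) = X at *
        calc B + X + (k • H + (H + H)) = B + (X + k • H) + (H + H) := by abel
          _ = B + (S + D + l • H) + (A + A) := by rw [e, e4]
          _ = A + B + S + (A + D) + l • H := by abel
          _ = _ := by rw [e3]; abel

lemma PL_InIq {L : List (F × F)} (h : (L.map fun t => t.1 * t.2).sum = 0) : InIq 2 (PL L) := by
  obtain ⟨T, k, l, hT, e⟩ := PL_decomp L
  refine ⟨T, hT, k, l + 1, ?_⟩
  rw [← cl_eq, cl_oplus, cl_oplus, cl_hypN, cl_hypN, e, h, cl_eq.2 isom_10, add_smul, one_smul]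
  abel

end QF

/-- **Example 3.1(1)** (Barry–Laghribi). Every excellent field extension `K/F` of a field
of characteristic 2 belongs to `E₂(F)`: it is excellent for the forms of `I²_q F`. -/
theorem stmt_5 (F : Type) [Field F] [CharP F 2]
    (K : Type) [Field K] [Algebra F K]
    (hexc : Excellent F K) :
    ExcellentI2 F K := by
  open QF in
  haveI : CharP K 2 := charP_of_injective_algebraMap (algebraMap F K).injective 2
  rintro φ ⟨T, hT, k, l, hiso⟩ hφ
  obtain ⟨ψ, hψ, i, j, hdec⟩ := hexc φ hφ
  -- `φ` as a sum of planes
  have hRA : RA (oplus φ (hypN k)).form := by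
    refine RA.equiv (RA.prod hφ ?_) (oplus_equiv φ (hypN k))
    rw [hypN_eq]
    exact RT_PL _
  obtain ⟨T', hT', hs⟩ := S_planes T hT (RA_oplus_left (hRA.equiv hiso))
  have h1 : Isom (oplus φ (hypN k)) (PL (T' ++ List.replicate l (0, 0))) := by
    rw [← cl_eq, cl_eq.2 hiso, cl_oplus, hT', hypN_eq, cl_PL_append]
  have h2 := bc_isom (K := K) h1
  rw [bc_oplus, bc_hypN, bc_PL] at h2
  have h3 : Isom (oplus (oplus (ψ.bc K) (oplus (hypN i) (zeroN j))) (hypN k))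
      (PL (mapL K (T' ++ List.replicate l (0, 0)))) :=
    (Isom.oplus hdec.symm (Isom.refl _)).trans h2
  have hRT : RT (oplus (ψ.bc K) (oplus (hypN i) (zeroN j))).form :=
    RT_oplus_left ((RT_PL _).equiv h3.symm)
  have hj : j = 0 := RT_zeroN (RT_oplus_right (RT_oplus_right hRT))
  subst hj
  have hz : cl (zeroN 0 : QF K) = 0 := rfl
  obtain ⟨L, hL⟩ := exists_PL ψ.n (Fin ψ.n → F) ψ.form (by simp) (RT_bc (RT_oplus_left hRT))
  have hLK : Isom (ψ.bc K) (PL (mapL K L)) := by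
    rw [← bc_PL]
    exact bc_isom hL
  have h4 : Isom (PL (mapL K L ++ (List.replicate i (0, 0) ++ List.replicate k (0, 0))))
      (PL (mapL K (T' ++ List.replicate l (0, 0)))) := by
    rw [← cl_eq, ← cl_eq.2 h3, cl_PL_append, cl_PL_append, ← hypN_eq, ← hypN_eq, cl_oplus, cl_oplus, cl_oplus,
      hz, ← cl_eq.2 hLK]
    abel
  obtain ⟨t, ht⟩ := arf_isom (arf_PL _) (arf_PL _) h4
  rw [List.map_append, List.sum_append, sum_mapL, sum_mapL] at ht
  simp only [List.map_append, List.map_replicate, mul_zero, List.sum_append, List.sum_replicate, smul_zero,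
    add_zero, map_zero, hs] at ht
  have hani : (PL (mapL K L)).form.Anisotropic := aniso_equiv hψ hLK
  cases L with
  | nil =>
    refine ⟨PL [], PL_InIq rfl, ?_, i, 0, ?_⟩
    · rw [bc_PL]; exact hani
    · rw [bc_PL]
      exact hdec.trans (Isom.oplus hLK (Isom.refl _))
  | cons u L =>
    obtain ⟨a, b⟩ := u
    have ha : algebraMap F K a ≠ 0 := by
      intro h0
      have hb : (bin (algebraMap F K a) (algebraMap F K b)).form.Anisotropic :=
        (QuadraticMap.anisotropic_of_prod (aniso_equiv hani
          (oplus_equiv (bin (algebraMap F K a) (algebraMap F K b)) (PL (mapL K L))).symm)).1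
      have := hb (![1, 0] : Fin 2 → K) ((bin_apply _ _ _).trans (by simp [h0]))
      have := congrFun this (0 : Fin 2)
      exact one_ne_zero this
    have ha' : a ≠ 0 := by
      rintro rfl
      exact ha (map_zero _)
    set δ : F := (((a, b) :: L).map fun t => t.1 * t.2).sum with hδ
    have hK : Isom (PL (mapL K ((a, b + δ / a) :: L))) (PL (mapL K ((a, b) :: L))) := by
      rw [← cl_eq]
      show cl (oplus (bin (algebraMap F K a) (algebraMap F K (b + δ / a))) (PL (mapL K L))) =
        cl (oplus (bin (algebraMap F K a) (algebraMap F K b)) (PL (mapL K L)))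
      rw [cl_oplus, cl_oplus, map_add, cl_eq.2 (isom_shift (t := t) ha _)]
      rw [← ht, ← map_mul]
      congr 1
      field_simp
    refine ⟨PL ((a, b + δ / a) :: L), PL_InIq ?_, ?_, i, 0, ?_⟩
    · have e : a * (δ / a) = δ := by field_simp
      simp only [List.map_cons, List.sum_cons, mul_add, e] at hδ ⊢
      linear_combination CharTwo.add_self_eq_zero δ - hδ
    · rw [bc_PL]; exact aniso_equiv hani hK.symm
    · rw [bc_PL]
      exact hdec.trans (Isom.oplus (hLK.trans hK.symm) (Isom.refl _))

end BL
end

section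
/- Let F be a field of characteristic 2 and M = F(℘⁻¹(a), ℘⁻¹(b), ℘⁻¹(c)) a separable triquadratic extension of F (so [M:F] = 8), and set K = F(α) where α satisfies α²+α = a. Let β = s + tα and γ = u + vα be elements of K^× with s,t,u,v ∈ F, and let φ = β[1,b] ⊥ γ[1,c] be the corresponding quadratic form over K. Then the following are equivalent: (1) φ is defined over F, i.e., φ ≅ ψ_K for some quadratic form ψ over F; (2) ⟨⟨N_{K/F}(β), b]] ≅ ⟨⟨N_{K/F}(γ), c]], and if tv ≠ 0 then tv is a value represented over F by ⟨⟨N_{K/F}(β), b]]. -/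
open scoped TensorProduct

namespace BL

variable (F : Type) [Field F]

variable (A : Type) [Ring A] [Algebra F A]

variable (K : Type) [Field K] [Algebra F K]

section core1
variable {F : Type} [Field F]

/-- explicit Pfister polynomial -/
def pf (m b : F) (x : Fin 4 → F) : F :=
  x 0 ^ 2 + x 0 * x 1 + b * x 1 ^ 2 + m * (x 2 ^ 2 + x 2 * x 3 + b * x 3 ^ 2)

def hyp4 (x : Fin 4 → F) : F := x 0 * x 1 + x 2 * x 3

def Iso4 (p q : (Fin 4 → F) → F) : Prop :=
  ∃ e : (Fin 4 → F) ≃ₗ[F] (Fin 4 → F), ∀ x, q (e x) = p x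

theorem Iso4.symm {p q : (Fin 4 → F) → F} (h : Iso4 p q) : Iso4 q p := by
  obtain ⟨e, he⟩ := h
  exact ⟨e.symm, fun x => by rw [← he]; simp⟩

theorem Iso4.trans {p q r : (Fin 4 → F) → F} (h : Iso4 p q) (h' : Iso4 q r) : Iso4 p r := by
  obtain ⟨e, he⟩ := h
  obtain ⟨e', he'⟩ := h'
  exact ⟨e.trans e', fun x => by simp [he, he']⟩

def lin4 (A : Matrix (Fin 4) (Fin 4) F) : (Fin 4 → F) →ₗ[F] (Fin 4 → F) := Matrix.toLin' A

theorem lin4_apply (A : Matrix (Fin 4) (Fin 4) F) (x : Fin 4 → F) (i : Fin 4) :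
    lin4 A x i = A i 0 * x 0 + A i 1 * x 1 + A i 2 * x 2 + A i 3 * x 3 := by
  simp [lin4, Matrix.mulVec, dotProduct, Fin.sum_univ_four]

variable [CharP F 2]

theorem pf_polar (m b : F) (x y : Fin 4 → F) : pf m b (x + y) = pf m b x + pf m b y +
    (x 0 * y 1 + x 1 * y 0 + m * (x 2 * y 3 + x 3 * y 2)) := by
  have h2 : (2 : F) = 0 := CharTwo.two_eq_zero
  simp only [pf, Pi.add_apply]
  grind

theorem pf_nondeg (m b : F) (hm : m ≠ 0) (x : Fin 4 → F)
    (h : ∀ y, pf m b (x + y) = pf m b x + pf m b y) : x = 0 := by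
  have h0 := h ![1, 0, 0, 0]
  have h1 := h ![0, 1, 0, 0]
  have h2 := h ![0, 0, 1, 0]
  have h3 := h ![0, 0, 0, 1]
  rw [pf_polar] at h0 h1 h2 h3
  simp at h0 h1 h2 h3
  ext i
  fin_cases i <;> simp_all

theorem pf_iso_of (m b r : F) (hm : m ≠ 0) (hr : r ≠ 0) (q : (Fin 4 → F) → F)
    (hq : q 0 = 0) (f : (Fin 4 → F) →ₗ[F] (Fin 4 → F)) (hf : ∀ x, q (f x) = r * pf m b x) :
    ∃ e : (Fin 4 → F) ≃ₗ[F] (Fin 4 → F), ∀ x, q (e x) = r * pf m b x := by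
  have hinj : Function.Injective f := by
    rw [← LinearMap.ker_eq_bot, LinearMap.ker_eq_bot']
    intro x hx
    apply pf_nondeg m b hm
    intro y
    have h1 := hf (x + y)
    have h2 := hf x
    have h3 := hf y
    rw [map_add, hx, zero_add, h3] at h1
    rw [hx, hq] at h2
    have h4 : pf m b x = 0 := by
      rcases mul_eq_zero.mp h2.symm with h | h
      · exact absurd h hr
      · exact h
    rw [h4, zero_add]
    exact (mul_left_cancel₀ hr h1).symm
  exact ⟨LinearEquiv.ofInjectiveEndo f hinj, fun x => by simpa using hf x⟩

theorem pf_mul (m b : F) (z : Fin 4 → F) : ∃ f : (Fin 4 → F) →ₗ[F] (Fin 4 → F),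
    ∀ x, pf m b (f x) = pf m b z * pf m b x := by
  have h2 : (2 : F) = 0 := CharTwo.two_eq_zero
  refine ⟨lin4 !![z 0, b * z 1, m * z 2, m * (z 2 + b * z 3);
      z 1, z 0 + z 1, m * z 3, m * z 2;
      z 2, z 2 + b * z 3, z 0, b * z 1;
      z 3, z 2, z 1, z 0 + z 1], ?_⟩
  · intro x
    simp [pf, lin4_apply]
    generalize x 0 = x0
    generalize x 1 = x1
    generalize x 2 = x2
    generalize x 3 = x3
    generalize z 0 = z0
    generalize z 1 = z1
    generalize z 2 = z2
    generalize z 3 = z3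
    grind

theorem pf_zero (m b : F) : pf m b 0 = 0 := by simp [pf]
theorem hyp4_zero : hyp4 (0 : Fin 4 → F) = 0 := by simp [hyp4]
theorem pf_smul (m b k : F) (x : Fin 4 → F) : pf m b (k • x) = k ^ 2 * pf m b x := by
  simp [pf]; ring

theorem pf_round (m b : F) (hm : m ≠ 0) (z : Fin 4 → F) (hz : pf m b z ≠ 0) :
    ∃ e : (Fin 4 → F) ≃ₗ[F] (Fin 4 → F), ∀ x, pf m b (e x) = pf m b z * pf m b x := by
  obtain ⟨f, hf⟩ := pf_mul m b z
  exact pf_iso_of m b _ hm hz _ (pf_zero m b) f hf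

theorem pf_hyp_of_split (m b e : F) (hm : m ≠ 0) (he : e ^ 2 + e = b) :
    Iso4 (pf m b) hyp4 := by
  have h2 : (2 : F) = 0 := CharTwo.two_eq_zero
  obtain ⟨g, hg⟩ := pf_iso_of m b 1 hm one_ne_zero hyp4 hyp4_zero
    (lin4 !![1, e, 0, 0; 1, e + 1, 0, 0; 0, 0, m, m * e; 0, 0, 1, e + 1]) (by
      intro x
      simp [pf, lin4_apply, hyp4]
      grind)
  exact ⟨g, fun x => by rw [hg, one_mul]⟩

theorem pf_hyp_of_norm (m b p q : F) (hm : m ≠ 0) (he : p ^ 2 + p * q + b * q ^ 2 = m) :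
    Iso4 (pf m b) hyp4 := by
  have h2 : (2 : F) = 0 := CharTwo.two_eq_zero
  obtain ⟨g, hg⟩ := pf_iso_of m b 1 hm one_ne_zero hyp4 hyp4_zero
    (lin4 !![1, 0, p, b * q; 1, 1, p, b * q; 0, 1, q, p + q; 0, b, b * q + p, b * p]) (by
      intro x
      simp [pf, lin4_apply, hyp4]
      subst he
      generalize x 0 = x0
      generalize x 1 = x1
      generalize x 2 = x2
      generalize x 3 = x3
      grind)
  exact ⟨g, fun x => by rw [hg, one_mul]⟩

theorem pf_hyp (m b : F) (hm : m ≠ 0) (x : Fin 4 → F) (hx : x ≠ 0) (h : pf m b x = 0) :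
    Iso4 (pf m b) hyp4 := by
  have h2 : (2 : F) = 0 := CharTwo.two_eq_zero
  have key : ∀ p q : F, p ^ 2 + p * q + b * q ^ 2 = 0 → (p ≠ 0 ∨ q ≠ 0) →
      Iso4 (pf m b) hyp4 := by
    intro p q hpq hne
    have hq : q ≠ 0 := by
      rintro rfl
      simp at hpq
      simp [hpq] at hne
    apply pf_hyp_of_split m b (p / q) hm
    field_simp
    grind
  by_cases hn : x 2 ^ 2 + x 2 * x 3 + b * x 3 ^ 2 = 0
  · by_cases h23 : x 2 ≠ 0 ∨ x 3 ≠ 0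
    · exact key _ _ hn h23
    · push Not at h23
      apply key (x 0) (x 1)
      · simpa [pf, h23] using h
      · by_contra hc
        push Not at hc
        apply hx
        ext i
        fin_cases i <;> simp_all
  · set n := x 2 ^ 2 + x 2 * x 3 + b * x 3 ^ 2 with hnd
    apply pf_hyp_of_norm m b ((x 0 * (x 2 + x 3) + x 1 * x 3 * b) / n)
      ((x 0 * x 3 + x 1 * (x 2 + x 3) + x 1 * x 3) / n) hm
    have h' : m * n = x 0 ^ 2 + x 0 * x 1 + b * x 1 ^ 2 := by
      simp only [pf] at h
      grind
    have h3 : (x 0 * (x 2 + x 3) + x 1 * x 3 * b) ^ 2 +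
        (x 0 * (x 2 + x 3) + x 1 * x 3 * b) * (x 0 * x 3 + x 1 * (x 2 + x 3) + x 1 * x 3) +
        b * (x 0 * x 3 + x 1 * (x 2 + x 3) + x 1 * x 3) ^ 2 =
        (x 0 ^ 2 + x 0 * x 1 + b * x 1 ^ 2) * n := by
      rw [hnd]
      generalize x 0 = x0
      generalize x 1 = x1
      generalize x 2 = x2
      generalize x 3 = x3
      clear * - h2
      grind
    rw [← h'] at h3
    field_simp
    linear_combination h3

/-- Similar Pfister forms. -/
theorem pf_similar (m b n c t v : F) (hm : m ≠ 0) (hn : n ≠ 0) (ht : t ≠ 0) (hv : v ≠ 0)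
    (e : (Fin 4 → F) ≃ₗ[F] (Fin 4 → F)) (he : ∀ x, t * pf n c (e x) = v * pf m b x) :
    Iso4 (pf m b) (pf n c) ∧ ∃ w, pf m b w = t * v := by
  have h1 : pf m b ![1, 0, 0, 0] = 1 := by simp [pf]
  have h2 : pf n c (t • e ![1, 0, 0, 0]) = t * v := by
    rw [pf_smul]
    have := he ![1, 0, 0, 0]
    rw [h1] at this
    linear_combination t * this
  have htv : t * v ≠ 0 := mul_ne_zero ht hv
  obtain ⟨g, hg⟩ := pf_round n c hn _ (by rw [h2]; exact htv)
  have hiso : Iso4 (pf m b) (pf n c) := by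
    refine ⟨(e.trans g).trans (LinearEquiv.smulOfNeZero F _ v⁻¹ (inv_ne_zero hv)), fun x => ?_⟩
    simp only [LinearEquiv.trans_apply, LinearEquiv.smulOfNeZero_apply]
    rw [pf_smul, hg, h2]
    have := he x
    field_simp
    linear_combination this
  refine ⟨hiso, ?_⟩
  obtain ⟨k, hk⟩ := hiso.symm
  exact ⟨k (t • e ![1, 0, 0, 0]), by rw [hk, h2]⟩

/-- Converse. -/
theorem pf_similar' (m b n c t v : F) (hn : n ≠ 0) (hm : m ≠ 0) (ht : t ≠ 0) (hv : v ≠ 0)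
    (h : Iso4 (pf m b) (pf n c)) (w : Fin 4 → F) (hw : pf m b w = t * v) :
    ∃ e : (Fin 4 → F) ≃ₗ[F] (Fin 4 → F), ∀ x, t * pf n c (e x) = v * pf m b x := by
  obtain ⟨k, hk⟩ := h
  have htv : t * v ≠ 0 := mul_ne_zero ht hv
  obtain ⟨g, hg⟩ := pf_round n c hn (k w) (by rw [hk, hw]; exact htv)
  refine ⟨(k.trans g).trans (LinearEquiv.smulOfNeZero F _ t⁻¹ (inv_ne_zero ht)), fun x => ?_⟩
  simp only [LinearEquiv.trans_apply, LinearEquiv.smulOfNeZero_apply]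
  rw [pf_smul, hg, hk, hk, hw]
  field_simp
end core1

section core2
variable {F K : Type} [Field F] [Field K] [Algebra F K] [CharP F 2]

structure QE (a : F) (α : K) (l : K →ₗ[F] F) : Prop where
  hα : α ^ 2 + α = algebraMap F K a
  l1 : l 1 = 0
  lα : l α = 1
  dec : ∀ k, ∃ x, k = algebraMap F K x + algebraMap F K (l k) * α

variable {a : F} {α : K} {l : K →ₗ[F] F}

theorem QE.l_alg (h : QE a α l) (x : F) : l (algebraMap F K x) = 0 := by
  rw [Algebra.algebraMap_eq_smul_one, map_smul, h.l1, smul_zero]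

theorem QE.l_lin (h : QE a α l) (x y : F) :
    l (algebraMap F K x + algebraMap F K y * α) = y := by
  rw [map_add, h.l_alg, ← Algebra.smul_def, map_smul, h.lα]; simp

theorem QE.two (_ : QE a α l) : (2 : K) = 0 := by
  have : (2 : F) = 0 := CharTwo.two_eq_zero
  have h := congrArg (algebraMap F K) this
  simpa only [map_ofNat, map_zero] using h

theorem QE.alg_of (h : QE a α l) (k : K) (hk : l k = 0) : ∃ x, k = algebraMap F K x := by
  obtain ⟨x, hx⟩ := h.dec k
  exact ⟨x, by rw [hx, hk]; simp⟩

theorem QE.zero_of (h : QE a α l) (k : K) (h0 : l k = 0) (h1 : l (α * k) = 0) : k = 0 := by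
  obtain ⟨x, rfl⟩ := h.alg_of k h0
  rw [mul_comm, ← Algebra.smul_def, map_smul, h.lα] at h1
  simp at h1
  simp [h1]

theorem QE.lin_zero (h : QE a α l) (x y : F)
    (hz : algebraMap F K x + algebraMap F K y * α = 0) : x = 0 ∧ y = 0 := by
  have := h.l_lin x y
  rw [hz, map_zero] at this
  subst this
  simpa using hz

theorem QE.α_ne (h : QE a α l) : α ≠ 0 := by
  intro h0
  have := h.lα
  simp [h0] at this

/-- coordinates -/
noncomputable def QE.equiv (h : QE a α l) : (F × F) ≃ₗ[F] K :=
  LinearEquiv.ofBijective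
    ((LinearMap.toSpanSingleton F K 1).comp (LinearMap.fst F F F) +
      (LinearMap.toSpanSingleton F K α).comp (LinearMap.snd F F F)) (by
    constructor
    · rw [← LinearMap.ker_eq_bot, LinearMap.ker_eq_bot']
      rintro ⟨x, y⟩ hxy
      simp [Algebra.smul_def] at hxy
      obtain ⟨rfl, rfl⟩ := h.lin_zero x y hxy
      rfl
    · intro k
      obtain ⟨x, hx⟩ := h.dec k
      refine ⟨(x, l k), ?_⟩
      simp [Algebra.smul_def]
      exact hx.symm)

theorem QE.fin (h : QE a α l) : FiniteDimensional F K :=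
  Module.Finite.equiv h.equiv

theorem QE.finrank (h : QE a α l) : Module.finrank F K = 2 := by
  rw [← h.equiv.finrank_eq]; simp

def rho (l : K →ₗ[F] F) (β : K) (b : F) (x : K × K) : F :=
  l (β * (x.1 ^ 2 + x.1 * x.2 + algebraMap F K b * x.2 ^ 2))

theorem rho_coord (h : QE a α l) (b s t x0 x1 y0 y1 : F) :
    rho l (algebraMap F K s + algebraMap F K t * α) b
      (algebraMap F K x0 + algebraMap F K x1 * α, algebraMap F K y0 + algebraMap F K y1 * α) =
    s * (x1 ^ 2 + (x0 * y1 + x1 * y0 + x1 * y1) + b * y1 ^ 2) +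
    t * (x0 ^ 2 + a * x1 ^ 2 + x0 * y0 + a * x1 * y1 + b * (y0 ^ 2 + a * y1 ^ 2)) +
    t * (x1 ^ 2 + (x0 * y1 + x1 * y0 + x1 * y1) + b * y1 ^ 2) := by
  have h2 := h.two
  have hα := h.hα
  rw [← h.l_lin (s * (x0 ^ 2 + a * x1 ^ 2 + x0 * y0 + a * x1 * y1 + b * (y0 ^ 2 + a * y1 ^ 2)) +
    a * t * (x1 ^ 2 + (x0 * y1 + x1 * y0 + x1 * y1) + b * y1 ^ 2))
    (s * (x1 ^ 2 + (x0 * y1 + x1 * y0 + x1 * y1) + b * y1 ^ 2) +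
    t * (x0 ^ 2 + a * x1 ^ 2 + x0 * y0 + a * x1 * y1 + b * (y0 ^ 2 + a * y1 ^ 2)) +
    t * (x1 ^ 2 + (x0 * y1 + x1 * y0 + x1 * y1) + b * y1 ^ 2))]
  unfold rho
  congr 1
  simp only [map_add, map_mul, map_pow]
  generalize algebraMap F K s = s at *
  generalize algebraMap F K t = t at *
  generalize algebraMap F K x0 = x0 at *
  generalize algebraMap F K x1 = x1 at *
  generalize algebraMap F K y0 = y0 at *
  generalize algebraMap F K y1 = y1 at *
  generalize algebraMap F K a = a at *
  generalize algebraMap F K b = b at *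
  subst hα
  grind

noncomputable def theta (l : K →ₗ[F] F) (β : K) : (K × K) →ₗ[F] (Fin 4 → F) :=
  LinearMap.pi ![l.comp ((LinearMap.mulLeft F β).comp (LinearMap.fst F K K)),
    l.comp ((LinearMap.mulLeft F β).comp (LinearMap.snd F K K)),
    l.comp (LinearMap.fst F K K), l.comp (LinearMap.snd F K K)]

theorem l_mul (h : QE a α l) (s t x y : F) :
    l ((algebraMap F K s + algebraMap F K t * α) * (algebraMap F K x + algebraMap F K y * α)) =
    s * y + t * x + t * y := by
  have h2 := h.two
  have hα := h.hα
  rw [← h.l_lin (s * x + a * t * y) (s * y + t * x + t * y)]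
  congr 1
  simp only [map_add, map_mul]
  grind

theorem theta_coord (h : QE a α l) (s t x0 x1 y0 y1 : F) :
    theta l (algebraMap F K s + algebraMap F K t * α)
      (algebraMap F K x0 + algebraMap F K x1 * α, algebraMap F K y0 + algebraMap F K y1 * α) =
    ![s * x1 + t * x0 + t * x1, s * y1 + t * y0 + t * y1, x1, y1] := by
  ext i
  fin_cases i
  · simp [theta]; exact l_mul h _ _ _ _
  · simp [theta]; exact l_mul h _ _ _ _
  · simp only [theta, LinearMap.pi_apply]; exact h.l_lin _ _
  · simp only [theta, LinearMap.pi_apply]; exact h.l_lin _ _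

theorem theta_pf (h : QE a α l) (b s t : F) (x : K × K) :
    pf (s ^ 2 + s * t + a * t ^ 2) b (theta l (algebraMap F K s + algebraMap F K t * α) x) =
      t * rho l (algebraMap F K s + algebraMap F K t * α) b x := by
  obtain ⟨x, y⟩ := x
  obtain ⟨x0, hx⟩ := h.dec x
  obtain ⟨y0, hy⟩ := h.dec y
  rw [hx, hy, theta_coord h, rho_coord h]
  have h2 : (2 : F) = 0 := CharTwo.two_eq_zero
  simp [pf]
  generalize l x = x1
  generalize l y = y1
  clear * - h2
  grind

theorem theta_equiv (h : QE a α l) (s t : F) (ht : t ≠ 0) :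
    ∃ e : (K × K) ≃ₗ[F] (Fin 4 → F), ∀ x,
      e x = theta l (algebraMap F K s + algebraMap F K t * α) x := by
  have := h.fin
  have hinj : Function.Injective (theta l (algebraMap F K s + algebraMap F K t * α)) := by
    rw [← LinearMap.ker_eq_bot, LinearMap.ker_eq_bot']
    rintro ⟨x, y⟩ hxy
    obtain ⟨x0, hx⟩ := h.dec x
    obtain ⟨y0, hy⟩ := h.dec y
    rw [hx, hy, theta_coord h] at hxy
    have h0 := congrFun hxy 0
    have h1 := congrFun hxy 1
    have h2 := congrFun hxy 2
    have h3 := congrFun hxy 3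
    simp at h0 h1 h2 h3
    simp [h2, h3, ht] at h0 h1
    rw [hx, hy, h0, h1, h2, h3]
    simp
  refine ⟨LinearMap.linearEquivOfInjective _ hinj ?_, fun x => rfl⟩
  simp [h.finrank]

theorem rho_pf (h : QE a α l) (b s t : F) (ht : t ≠ 0) :
    ∃ e : (K × K) ≃ₗ[F] (Fin 4 → F), ∀ x, pf (s ^ 2 + s * t + a * t ^ 2) b (e x) =
      t * rho l (algebraMap F K s + algebraMap F K t * α) b x := by
  obtain ⟨e, he⟩ := theta_equiv h s t ht
  exact ⟨e, fun x => by rw [he, theta_pf h]⟩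

theorem pf_iso_of_rho (h : QE a α l) (b s t : F) (x : K × K) (hx : x ≠ 0)
    (hr : rho l (algebraMap F K s + algebraMap F K t * α) b x = 0) :
    ∃ y : Fin 4 → F, y ≠ 0 ∧ pf (s ^ 2 + s * t + a * t ^ 2) b y = 0 := by
  by_cases ht : t = 0
  · subst ht
    refine ⟨![s, 0, 1, 0], fun h0 => ?_, ?_⟩
    · have := congrFun h0 2
      simp at this
    · simp [pf, CharTwo.add_self_eq_zero]
  · obtain ⟨e, he⟩ := rho_pf h b s t ht
    exact ⟨e x, by simpa using hx, by rw [he, hr, mul_zero]⟩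

theorem rho_tzero (h : QE a α l) (b s x y : F) :
    rho l (algebraMap F K s) b (algebraMap F K x, algebraMap F K y) = 0 := by
  have := rho_coord h b s 0 x 0 y 0
  simpa using this

theorem rho_hyp (h : QE a α l) (b s t : F) (hm : s ^ 2 + s * t + a * t ^ 2 ≠ 0)
    (y : Fin 4 → F) (hy : y ≠ 0) (hp : pf (s ^ 2 + s * t + a * t ^ 2) b y = 0) :
    ∃ j : (F × F) →ₗ[F] K × K, Function.Injective j ∧
      ∀ z, rho l (algebraMap F K s + algebraMap F K t * α) b (j z) = 0 := by
  by_cases ht : t = 0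
  · subst ht
    refine ⟨((Algebra.linearMap F K).prodMap (Algebra.linearMap F K)), ?_, ?_⟩
    · exact Function.Injective.prodMap (algebraMap F K).injective (algebraMap F K).injective
    · rintro ⟨x, y⟩
      simpa using rho_tzero h b s x y
  · obtain ⟨e, he⟩ := rho_pf h b s t ht
    obtain ⟨g, hg⟩ := (pf_hyp _ b hm y hy hp).symm
    let i : (F × F) →ₗ[F] (Fin 4 → F) :=
      LinearMap.pi ![LinearMap.fst F F F, 0, LinearMap.snd F F F, 0]
    have hi : ∀ z, i z = ![z.1, 0, z.2, 0] := by
      intro z; ext k; fin_cases k <;> rfl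
    refine ⟨(e.symm.toLinearMap.comp g.toLinearMap).comp i, ?_, ?_⟩
    · have : Function.Injective i := by
        intro z w hzw
        rw [hi, hi] at hzw
        have h0 := congrFun hzw 0
        have h2 := congrFun hzw 2
        simp at h0 h2
        exact Prod.ext h0 h2
      exact (e.symm.injective.comp g.injective).comp this
    · intro z
      have h1 := he (e.symm (g (i z)))
      rw [LinearEquiv.apply_symm_apply, hg, hi] at h1
      simp [hyp4, ht] at h1
      rw [← hi] at h1
      simpa using h1

theorem rho_zero (β : K) (b : F) : rho l β b 0 = 0 := by simp [rho]

theorem rho_nondeg (h : QE a α l) (β : K) (hβ : β ≠ 0) (b : F) (x : K × K)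
    (hx : ∀ y, rho l β b (x + y) = rho l β b x + rho l β b y) : x = 0 := by
  have h2 := h.two
  have hp : ∀ y, rho l β b (x + y) =
      rho l β b x + rho l β b y + l (β * (x.1 * y.2 + x.2 * y.1)) := by
    intro y
    simp only [rho, ← map_add]
    congr 1
    simp only [Prod.fst_add, Prod.snd_add]
    grind
  have hq : ∀ y : K × K, l (β * (x.1 * y.2 + x.2 * y.1)) = 0 := by
    intro y
    have := hp y
    rw [hx] at this
    simpa using this
  have e1 := h.zero_of (β * x.1) (by simpa using hq (0, 1))
    (by have := hq (0, α); simp at this; rw [← this]; congr 1; ring)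
  have e2 := h.zero_of (β * x.2) (by simpa using hq (1, 0))
    (by have := hq (α, 0); simp at this; rw [← this]; congr 1; ring)
  simp [hβ] at e1 e2
  exact Prod.ext e1 e2

theorem graph (h : QE a α l) (β γ : K) (hγ : γ ≠ 0) (b c : F)
    (g1 g2 : (Fin 4 → F) →ₗ[F] K × K) (hinj : ∀ z, g1 z = 0 → g2 z = 0 → z = 0)
    (hg : ∀ z, rho l β b (g1 z) = rho l γ c (g2 z))
    (han : ∀ x, rho l β b x = 0 → x = 0) :
    ∃ e : (K × K) ≃ₗ[F] (K × K), ∀ x, rho l γ c (e x) = rho l β b x := by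
  have := h.fin
  have hd : Module.finrank F (Fin 4 → F) = Module.finrank F (K × K) := by simp [h.finrank]
  have i2 : Function.Injective g2 := by
    rw [← LinearMap.ker_eq_bot, LinearMap.ker_eq_bot']
    intro z hz
    refine hinj z (han _ ?_) hz
    rw [hg, hz, rho_zero]
  let e2 := LinearMap.linearEquivOfInjective g2 i2 hd
  have he2 : ∀ z, e2 z = g2 z := fun z => rfl
  have i1 : Function.Injective g1 := by
    rw [← LinearMap.ker_eq_bot, LinearMap.ker_eq_bot']
    intro z hz
    refine hinj z hz (rho_nondeg h γ hγ c _ fun y => ?_)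
    obtain ⟨w, rfl⟩ := e2.surjective y
    rw [he2, ← map_add, ← hg, ← hg, ← hg, map_add, hz, rho_zero]
    simp
  let e1 := LinearMap.linearEquivOfInjective g1 i1 hd
  have he1 : ∀ z, e1 z = g1 z := fun z => rfl
  refine ⟨e1.symm.trans e2, fun x => ?_⟩
  obtain ⟨z, rfl⟩ := e1.surjective x
  rw [LinearEquiv.trans_apply, LinearEquiv.symm_apply_apply, he2, ← hg, he1]

/-- Forward core. -/
theorem forward_core (h : QE a α l) (b c s t u v : F)
    (hm : s ^ 2 + s * t + a * t ^ 2 ≠ 0) (hn : u ^ 2 + u * v + a * v ^ 2 ≠ 0)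
    (hβ : algebraMap F K s + algebraMap F K t * α ≠ 0)
    (hγ : algebraMap F K u + algebraMap F K v * α ≠ 0)
    (g1 g2 : (Fin 4 → F) →ₗ[F] K × K) (hinj : ∀ z, g1 z = 0 → g2 z = 0 → z = 0)
    (hg : ∀ z, rho l (algebraMap F K s + algebraMap F K t * α) b (g1 z) =
      rho l (algebraMap F K u + algebraMap F K v * α) c (g2 z)) :
    Iso4 (pf (s ^ 2 + s * t + a * t ^ 2) b) (pf (u ^ 2 + u * v + a * v ^ 2) c) ∧
      ∃ w, pf (s ^ 2 + s * t + a * t ^ 2) b w = t * v := by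
  have main : ∀ (e : (K × K) ≃ₗ[F] (K × K)), 
      (∀ x, rho l (algebraMap F K u + algebraMap F K v * α) c (e x) =
        rho l (algebraMap F K s + algebraMap F K t * α) b x) →
      (∀ x, rho l (algebraMap F K s + algebraMap F K t * α) b x = 0 → x = 0) →
      Iso4 (pf (s ^ 2 + s * t + a * t ^ 2) b) (pf (u ^ 2 + u * v + a * v ^ 2) c) ∧
      ∃ w, pf (s ^ 2 + s * t + a * t ^ 2) b w = t * v := by
    intro e he han
    have ht : t ≠ 0 := by
      rintro rfl
      have h1 := han (algebraMap F K 1, algebraMap F K 0) (by simpa using rho_tzero h b s 1 0)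
      simp at h1
    have hv : v ≠ 0 := by
      rintro rfl
      have h1 := han (e.symm (algebraMap F K 1, algebraMap F K 0))
        (by rw [← he]; simpa using rho_tzero h c u 1 0)
      simp at h1
    obtain ⟨e1, he1⟩ := rho_pf h b s t ht
    obtain ⟨e2, he2⟩ := rho_pf h c u v hv
    refine pf_similar _ b _ c t v hm hn ht hv ((e1.symm.trans e).trans e2) fun x => ?_
    obtain ⟨x, rfl⟩ := e1.surjective x
    simp [he1, he2, he]
    ring
  by_cases h1 : ∀ x, rho l (algebraMap F K s + algebraMap F K t * α) b x = 0 → x = 0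
  · obtain ⟨e, he⟩ := graph h _ _ hγ b c g1 g2 hinj hg h1
    exact main e he h1
  by_cases h2 : ∀ x, rho l (algebraMap F K u + algebraMap F K v * α) c x = 0 → x = 0
  · obtain ⟨e, he⟩ := graph h _ _ hβ c b g2 g1 (fun z a b => hinj z b a) (fun z => (hg z).symm) h2
    refine absurd (fun x hx => ?_) h1
    have := h2 (e.symm x) (by rw [← he]; simpa using hx)
    simpa using this
  push Not at h1 h2
  obtain ⟨x, hx, hx0⟩ := h1
  obtain ⟨y, hy, hy0⟩ := h2
  obtain ⟨x', hx', hx0'⟩ := pf_iso_of_rho h b s t x hx0 hx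
  obtain ⟨y', hy', hy0'⟩ := pf_iso_of_rho h c u v y hy0 hy
  have k1 := pf_hyp _ b hm x' hx' hx0'
  have k2 := pf_hyp _ c hn y' hy' hy0'
  refine ⟨k1.trans k2.symm, ?_⟩
  obtain ⟨e, he⟩ := k1.symm
  exact ⟨e ![t, v, 0, 0], by rw [he]; simp [hyp4]⟩

/-- Backward core. -/
theorem backward_core (h : QE a α l) (b c s t u v : F)
    (hm : s ^ 2 + s * t + a * t ^ 2 ≠ 0) (hn : u ^ 2 + u * v + a * v ^ 2 ≠ 0)
    (hiso : Iso4 (pf (s ^ 2 + s * t + a * t ^ 2) b) (pf (u ^ 2 + u * v + a * v ^ 2) c))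
    (hw : t * v ≠ 0 → ∃ w, pf (s ^ 2 + s * t + a * t ^ 2) b w = t * v) :
    ∃ (g1 g2 : (Fin 4 → F) →ₗ[F] K × K), (∀ z, g1 z = 0 → g2 z = 0 → z = 0) ∧
     ∀ z, rho l (algebraMap F K s + algebraMap F K t * α) b (g1 z) =
      rho l (algebraMap F K u + algebraMap F K v * α) c (g2 z) := by
  by_cases htv : t * v = 0
  · have key : (∃ y : Fin 4 → F, y ≠ 0 ∧ pf (s ^ 2 + s * t + a * t ^ 2) b y = 0) ∧
        (∃ y : Fin 4 → F, y ≠ 0 ∧ pf (u ^ 2 + u * v + a * v ^ 2) c y = 0) := by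
      rcases mul_eq_zero.mp htv with ht | hv
      · have h1 := pf_iso_of_rho h b s t (1, 0) (by simp)
          (by subst ht; simpa using rho_tzero h b s 1 0)
        refine ⟨h1, ?_⟩
        obtain ⟨y, hy, hy0⟩ := h1
        obtain ⟨e, he⟩ := hiso
        exact ⟨e y, by simpa using hy, by rw [he, hy0]⟩
      · have h1 := pf_iso_of_rho h c u v (1, 0) (by simp)
          (by subst hv; simpa using rho_tzero h c u 1 0)
        refine ⟨?_, h1⟩
        obtain ⟨y, hy, hy0⟩ := h1
        obtain ⟨e, he⟩ := hiso.symm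
        exact ⟨e y, by simpa using hy, by rw [he, hy0]⟩
    obtain ⟨⟨x, hx, hx0⟩, y, hy, hy0⟩ := key
    obtain ⟨j1, hj1, hr1⟩ := rho_hyp h b s t hm x hx hx0
    obtain ⟨j2, hj2, hr2⟩ := rho_hyp h c u v hn y hy hy0
    refine ⟨j1.comp ((LinearMap.proj 0).prod (LinearMap.proj 1)),
      j2.comp ((LinearMap.proj 2).prod (LinearMap.proj 3)), fun z h1 h2 => ?_, fun z => ?_⟩
    · have e1 := hj1 (h1.trans (map_zero j1).symm)
      have e2 := hj2 (h2.trans (map_zero j2).symm)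
      simp at e1 e2
      ext i
      fin_cases i <;> simp [e1, e2]
    · simp [hr1, hr2]
  · obtain ⟨w, hw⟩ := hw htv
    have ht : t ≠ 0 := left_ne_zero_of_mul htv
    have hv : v ≠ 0 := right_ne_zero_of_mul htv
    obtain ⟨e, he⟩ := pf_similar' _ b _ c t v hn hm ht hv hiso w hw
    obtain ⟨e1, he1⟩ := rho_pf h b s t ht
    obtain ⟨e2, he2⟩ := rho_pf h c u v hv
    refine ⟨e1.symm.toLinearMap, (e.trans e2.symm).toLinearMap, fun z h1 _ => by simpa using h1, 
      fun z => ?_⟩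
    have k0 := he z
    have k1 := he1 (e1.symm z)
    have k2 := he2 (e2.symm (e z))
    simp only [LinearEquiv.apply_symm_apply] at k1 k2
    rw [k1, k2] at k0
    simp only [LinearEquiv.coe_coe, LinearEquiv.trans_apply]
    apply mul_left_cancel₀ htv
    linear_combination -k0

end core2

section core3
variable {F K V : Type} [Field F] [Field K] [Algebra F K] [CharP F 2]
variable {a : F} {α : K} {l : K →ₗ[F] F}
variable [AddCommGroup V] [Module K V] [Module F V] [IsScalarTower F K V]

/-- The part of `W` stable under `α`. -/
def stab (α : K) (W : Submodule F V) : Submodule F V :=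
  W ⊓ W.comap (((LinearMap.lsmul K V) α).restrictScalars F)

theorem mem_stab (W : Submodule F V) (w : V) : w ∈ stab α W ↔ w ∈ W ∧ α • w ∈ W := by
  simp [stab]

theorem descent_step (h : QE a α l) [FiniteDimensional F V] (Q : QuadraticForm K V)
    (hQ : ∀ x : V, x ≠ 0 → ∃ y, QuadraticMap.polar Q x y ≠ 0)
    (W : Submodule F V) (hW : ∀ w ∈ W, l (Q w) = 0) (hs : stab α W ≠ ⊥) :
    ∃ W' : Submodule F V, Module.finrank F W' = Module.finrank F W ∧
      (∀ w ∈ W', l (Q w) = 0) ∧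
      Module.finrank F (stab α W') < Module.finrank F (stab α W) := by
  have hfin := h.fin
  have h2 := h.two
  obtain ⟨e, he, he0⟩ := Submodule.exists_mem_ne_zero_of_ne_bot hs
  rw [mem_stab] at he
  obtain ⟨heW, hαe⟩ := he
  have hke : ∀ k : K, k • e ∈ W := by
    intro k
    obtain ⟨x, hx⟩ := h.dec k
    rw [hx, add_smul, mul_smul, algebraMap_smul, algebraMap_smul]
    exact W.add_mem (W.smul_mem _ heW) (W.smul_mem _ hαe)
  have hB : ∀ x y, Q (x + y) = Q x + Q y + QuadraticMap.polarBilin Q x y := by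
    intro x y
    simp [QuadraticMap.polar]
  set B := QuadraticMap.polarBilin Q with hBdef
  have hBs : ∀ x y, B x y = B y x := by
    intro x y
    simp [hBdef, QuadraticMap.polar_comm]
  have hBB : ∀ x, B x x = 0 := by
    intro x
    simp [hBdef, QuadraticMap.polar_self, h2]
  have hQe : Q e = 0 := by
    apply h.zero_of
    · exact hW e heW
    · have h1 := hW _ hαe
      rw [QuadraticMap.map_smul, smul_eq_mul] at h1
      have h3 : α * α = algebraMap F K a + α := by
        have := h.hα
        linear_combination this - α * h2
      rw [h3, add_mul, map_add, ← Algebra.smul_def, map_smul, hW e heW] at h1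
      simpa using h1
  have hWB : ∀ w ∈ W, ∀ z ∈ W, l (B w z) = 0 := by
    intro w hw z hz
    have h1 := hW _ (W.add_mem hw hz)
    rw [hB, map_add, map_add, hW w hw, hW z hz] at h1
    simpa using h1
  have hWe : ∀ w ∈ W, B w e = 0 := by
    intro w hw
    apply h.zero_of
    · exact hWB w hw e heW
    · have := hWB w hw _ hαe
      simpa using this
  obtain ⟨f, hef, hQf⟩ : ∃ f, B e f = 1 ∧ Q f = 0 := by
    obtain ⟨y, hy⟩ := hQ e he0
    have hy' : B e y ≠ 0 := by simpa [hBdef] using hy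
    obtain ⟨f0, h1⟩ : ∃ f0, B e f0 = 1 :=
      ⟨(B e y)⁻¹ • y, by rw [map_smul, smul_eq_mul, inv_mul_cancel₀ hy']⟩
    refine ⟨f0 + Q f0 • e, ?_, ?_⟩
    · rw [map_add, map_smul, hBB, h1]; simp
    · rw [hB, QuadraticMap.map_smul, hQe, map_smul, hBs, h1]
      simp only [smul_eq_mul]
      linear_combination Q f0 * h2
  have hfe : B f e = 1 := by rw [hBs, hef]
  -- functional
  let L : W →ₗ[F] K := ((B.flip f).restrictScalars F).comp W.subtype
  have hL : ∀ w : W, L w = B w f := fun w => rfl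
  have hLs : Function.Surjective L := by
    intro k
    refine ⟨⟨k • e, hke k⟩, ?_⟩
    rw [hL]
    simp [hef]
  have hrk := LinearMap.finrank_range_add_finrank_ker L
  rw [LinearMap.range_eq_top.mpr hLs, finrank_top, h.finrank] at hrk
  let W0 := LinearMap.ker L
  let G : (W0 × (F × F)) →ₗ[F] V :=
    (W.subtype.comp W0.subtype).coprod
      ((LinearMap.toSpanSingleton F V e).coprod (LinearMap.toSpanSingleton F V f))
  have hG : ∀ z, G z = (z.1 : V) + (z.2.1 • e + z.2.2 • f) := fun z => rfl
  have hW0 : ∀ w : W0, B (w : V) f = 0 := fun w => w.2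
  have hBe : ∀ z, B (G z) e = algebraMap F K z.2.2 := by
    intro z
    rw [hG, map_add, map_add, ← algebraMap_smul K z.2.1, ← algebraMap_smul K z.2.2]
    simp [-algebraMap_smul, hBB, hfe, hWe _ z.1.1.2]
  have hBf : ∀ z, B (G z) f = algebraMap F K z.2.1 := by
    intro z
    rw [hG, map_add, map_add, ← algebraMap_smul K z.2.1, ← algebraMap_smul K z.2.2]
    simp [-algebraMap_smul, hBB, hef, hW0]
  have hGi : Function.Injective G := by
    rw [← LinearMap.ker_eq_bot, LinearMap.ker_eq_bot']
    intro z hz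
    have h1 := hBe z
    have h3 := hBf z
    rw [hz] at h1 h3
    simp only [map_zero, LinearMap.zero_apply] at h1 h3
    replace h1 := (map_eq_zero (algebraMap F K)).mp h1.symm
    replace h3 := (map_eq_zero (algebraMap F K)).mp h3.symm
    have h4 := hG z
    rw [hz, h1, h3] at h4
    simp at h4
    exact Prod.ext (Subtype.ext (Subtype.ext h4.symm)) (Prod.ext h3 h1)
  refine ⟨LinearMap.range G, ?_, ?_, ?_⟩
  · rw [LinearMap.finrank_range_of_inj hGi]
    rw [← hrk]
    simp [W0]
    ring
  · rintro _ ⟨z, rfl⟩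
    have hq : Q (G z) = Q (z.1 : V) + algebraMap F K (z.2.1 * z.2.2) := by
      rw [hG, hB, hB, map_add, ← algebraMap_smul K z.2.1, ← algebraMap_smul K z.2.2]
      simp [-algebraMap_smul, QuadraticMap.map_smul, hQe, hQf, hef, hW0, hWe _ z.1.1.2]
      ring
    rw [hq, map_add, h.l_alg, hW _ z.1.1.2, zero_add]
  · apply Submodule.finrank_lt_finrank_of_lt
    have hsub : ∀ w ∈ stab α (LinearMap.range G), w ∈ stab α W ∧ B w f = 0 := by
      intro w hw
      rw [mem_stab] at hw
      obtain ⟨⟨z, rfl⟩, ⟨z', hz'⟩⟩ := hw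
      have h1 := hBe z'
      have h3 := hBf z'
      rw [hz'] at h1 h3
      simp only [map_smul, LinearMap.smul_apply, hBe, hBf, smul_eq_mul] at h1 h3
      have k1 := h.lin_zero z'.2.2 z.2.2 (by linear_combination -h1 + (algebraMap F K z.2.2) * α * h2)
      have k3 := h.lin_zero z'.2.1 z.2.1 (by linear_combination -h3 + (algebraMap F K z.2.1) * α * h2)
      rw [hBf, k3.2]
      rw [hG z', hG z, k1.1, k1.2, k3.1, k3.2] at hz'
      rw [hG z, k1.2, k3.2, mem_stab]
      simp at hz' ⊢
      rw [← hz']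
      simp
    refine lt_of_le_of_ne (fun w hw => (hsub w hw).1) fun heq => ?_
    have : e ∈ stab α (LinearMap.range G) := by
      rw [heq, mem_stab]; exact ⟨heW, hαe⟩
    have := (hsub e this).2
    rw [hef] at this
    exact one_ne_zero this

theorem descent (h : QE a α l) [FiniteDimensional F V] (Q : QuadraticForm K V)
    (hQ : ∀ x : V, x ≠ 0 → ∃ y, QuadraticMap.polar Q x y ≠ 0) (n : ℕ)
    (W : Submodule F V) (hW : ∀ w ∈ W, l (Q w) = 0) (hn : Module.finrank F (stab α W) = n) :
    ∃ W' : Submodule F V, Module.finrank F W' = Module.finrank F W ∧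
      (∀ w ∈ W', l (Q w) = 0) ∧ stab α W' = ⊥ := by
  induction n using Nat.strong_induction_on generalizing W with
  | _ n ih =>
    by_cases hs : stab α W = ⊥
    · exact ⟨W, rfl, hW, hs⟩
    · obtain ⟨W1, h1, h2, h3⟩ := descent_step h Q hQ W hW hs
      obtain ⟨W2, k1, k2, k3⟩ := ih _ (hn ▸ h3) W1 h2 rfl
      exact ⟨W2, k1.trans h1, k2, k3⟩

theorem descent_basis (h : QE a α l) [FiniteDimensional F V] (Q : QuadraticForm K V)
    (hQ : ∀ x : V, x ≠ 0 → ∃ y, QuadraticMap.polar Q x y ≠ 0) (n : ℕ)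
    (hV : Module.finrank K V = n)
    (W : Submodule F V) (hW : ∀ w ∈ W, l (Q w) = 0) (hn : Module.finrank F W = n) :
    ∃ bs : Module.Basis (Fin n) K V, (∀ i, l (Q (bs i)) = 0) ∧
      ∀ i j, l (QuadraticMap.polar Q (bs i) (bs j)) = 0 := by
  obtain ⟨W', h1, h2, h3⟩ := descent h Q hQ _ W hW rfl
  have hfin : FiniteDimensional K V := Module.Finite.of_restrictScalars_finite F K V
  let bw := Module.finBasisOfFinrankEq F W' (h1.trans hn)
  have hli : LinearIndependent K (fun i => (bw i : V)) := by
    rw [Fintype.linearIndependent_iff]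
    intro g hg
    choose x hx using fun i => h.dec (g i)
    have e1 : ((∑ i, x i • bw i : W') : V) + α • ((∑ i, l (g i) • bw i : W') : V) = 0 := by
      rw [← hg]
      push_cast
      rw [Finset.smul_sum, ← Finset.sum_add_distrib]
      refine Finset.sum_congr rfl fun i _ => ?_
      conv_rhs => rw [hx i, add_smul, mul_comm, mul_smul, algebraMap_smul, algebraMap_smul]
    have e2 : ((∑ i, l (g i) • bw i : W') : V) ∈ stab α W' := by
      rw [mem_stab]
      refine ⟨Subtype.mem _, ?_⟩
      rw [eq_neg_of_add_eq_zero_right e1]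
      exact W'.neg_mem (Subtype.mem _)
    rw [h3, Submodule.mem_bot] at e2
    rw [e2, smul_zero, add_zero] at e1
    have l1 := Fintype.linearIndependent_iff.mp bw.linearIndependent _ (Subtype.ext e1)
    have l2 := Fintype.linearIndependent_iff.mp bw.linearIndependent _ (Subtype.ext e2)
    intro i
    rw [hx i, l1 i, l2 i]
    simp
  refine ⟨basisOfLinearIndependentOfCardEqFinrank' _ hli (by simp [hV]), ?_, ?_⟩
  · intro i
    simp [h2]
  · intro i j
    simp [QuadraticMap.polar, h2, W'.add_mem]

end core3

section core4
variable {F K : Type} [Field F] [Field K]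

theorem form_apply (q : QF F) (w : Fin q.n → F) :
    q.form w = ∑ i, ∑ j, w i * q.M i j * w j := by
  change Matrix.toLinearMap₂' F q.M w w = _
  rw [Matrix.toLinearMap₂'_apply]
  refine Finset.sum_congr rfl fun i _ => Finset.sum_congr rfl fun j _ => ?_
  simp only [smul_eq_mul]
  ring

theorem form_four (M : Matrix (Fin 4) (Fin 4) F) (w : Fin 4 → F) :
    (QF.mk 4 M).form w = ∑ i, ∑ j, w i * M i j * w j := form_apply (QF.mk 4 M) w

theorem sum_mat (p q r s p' q' r' s' : F) :
    QF.oplus ⟨2, !![p, q; r, s]⟩ ⟨2, !![p', q'; r', s']⟩ =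
      ⟨4, !![p, q, 0, 0; r, s, 0, 0; 0, 0, p', q'; 0, 0, r', s']⟩ := by
  unfold QF.oplus
  congr 1
  ext i j
  fin_cases i <;> fin_cases j <;> rfl

theorem sm_bin (k b : F) : QF.sm k (QF.bin 1 b) = ⟨2, !![k, k; 0, k * b]⟩ := by
  unfold QF.sm QF.bin
  congr 1
  ext i j
  fin_cases i <;> fin_cases j <;> simp

theorem qpf_eq (m b : F) : QF.qpf [m] b =
    ⟨4, !![1, 1, 0, 0; 0, b, 0, 0; 0, 0, m, m; 0, 0, 0, m * b]⟩ := by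
  simp only [QF.qpf, sm_bin]
  exact sum_mat _ _ _ _ _ _ _ _

theorem phi_eq (β γ b c : F) : QF.oplus (QF.sm β (QF.bin 1 b)) (QF.sm γ (QF.bin 1 c)) =
    ⟨4, !![β, β, 0, 0; 0, β * b, 0, 0; 0, 0, γ, γ; 0, 0, 0, γ * c]⟩ := by
  simp only [sm_bin]
  exact sum_mat _ _ _ _ _ _ _ _

theorem qpf_form (m b : F) (w : Fin 4 → F) :
    (QF.mk 4 !![1, 1, 0, 0; 0, b, 0, 0; 0, 0, m, m; 0, 0, 0, m * b]).form w = pf m b w := by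
  rw [form_four]
  simp [Fin.sum_univ_four, pf]
  ring

theorem phi_form (β γ b c : F) (w : Fin 4 → F) :
    (QF.mk 4 !![β, β, 0, 0; 0, β * b, 0, 0; 0, 0, γ, γ; 0, 0, 0, γ * c]).form w =
      β * (w 0 ^ 2 + w 0 * w 1 + b * w 1 ^ 2) + γ * (w 2 ^ 2 + w 2 * w 3 + c * w 3 ^ 2) := by
  rw [form_four]
  simp [Fin.sum_univ_four]
  ring

theorem isom_iff (m b n c : F) : QF.Isom (QF.qpf [m] b) (QF.qpf [n] c) ↔
    Iso4 (pf m b) (pf n c) := by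
  rw [qpf_eq, qpf_eq]
  constructor
  · rintro ⟨e⟩
    exact ⟨e.toLinearEquiv, fun x => by
      have := e.map_app x
      rw [qpf_form, qpf_form] at this
      exact this⟩
  · rintro ⟨e, he⟩
    exact ⟨⟨e, fun x => by
      exact ((qpf_form n c _).trans (he x)).trans (qpf_form m b x).symm⟩⟩

theorem rep_iff (m b r : F) : (∃ w, (QF.qpf [m] b).form w = r) ↔ ∃ w, pf m b w = r := by
  rw [qpf_eq]
  constructor
  · rintro ⟨w, hw⟩
    exact ⟨w, by rw [← hw]; exact (qpf_form m b w).symm⟩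
  · rintro ⟨w, hw⟩
    exact ⟨w, by rw [← hw]; exact qpf_form m b w⟩

variable [Algebra F K] [CharP F 2] {a : F} {α : K} {l : K →ₗ[F] F}

theorem l_phi (β γ : K) (b c : F) (w : Fin 4 → K) :
    l ((QF.mk 4 !![β, β, 0, 0; 0, β * algebraMap F K b, 0, 0; 0, 0, γ, γ;
      0, 0, 0, γ * algebraMap F K c]).form w) =
      rho l β b (w 0, w 1) + rho l γ c (w 2, w 3) := by
  rw [phi_form, map_add]
  rfl

theorem phi_nondeg (h : QE a α l) (β γ : K) (hβ : β ≠ 0) (hγ : γ ≠ 0) (b c : K)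
    (x : Fin 4 → K) (hx : x ≠ 0) : ∃ y, QuadraticMap.polar ((QF.mk 4 !![β, β, 0, 0;
      0, β * b, 0, 0; 0, 0, γ, γ; 0, 0, 0, γ * c]).form) x y ≠ 0 := by
  have h2 := h.two
  by_contra! hc
  have hp : ∀ y : Fin 4 → K, β * (x 0 * y 1 + x 1 * y 0) + γ * (x 2 * y 3 + x 3 * y 2) = 0 := by
    intro y
    have := hc y
    simp only [QuadraticMap.polar] at this
    erw [phi_form, phi_form, phi_form] at this
    simp only [Pi.add_apply] at this
    grind
  apply hx
  have h0 := hp ![1, 0, 0, 0]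
  have h1 := hp ![0, 1, 0, 0]
  have h3 := hp ![0, 0, 1, 0]
  have h4 := hp ![0, 0, 0, 1]
  simp [hβ, hγ] at h0 h1 h3 h4
  ext i
  fin_cases i <;> simp [h0, h1, h3, h4]

theorem defined_iff (h : QE a α l) (β γ : K) (hβ : β ≠ 0) (hγ : γ ≠ 0) (b c : F) :
    (∃ ψ : QF F, QF.Isom (QF.oplus (QF.sm β (QF.bin 1 (algebraMap F K b)))
            (QF.sm γ (QF.bin 1 (algebraMap F K c)))) (ψ.bc K)) ↔
    ∃ (g1 g2 : (Fin 4 → F) →ₗ[F] K × K), (∀ z, g1 z = 0 → g2 z = 0 → z = 0) ∧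
     ∀ z, rho l β b (g1 z) = rho l γ c (g2 z) := by
  rw [phi_eq]
  have hF2 : (2 : F) = 0 := CharTwo.two_eq_zero
  constructor
  · rintro ⟨⟨n, M⟩, ⟨E⟩⟩
    have hn : n = 4 := by
      have := E.toLinearEquiv.finrank_eq
      have h1 : Module.finrank K (Fin 4 → K) = Module.finrank K (Fin n → K) := this
      simpa using h1.symm
    subst hn
    let e : (Fin 4 → K) ≃ₗ[K] (Fin 4 → K) := E.toLinearEquiv
    have he : ∀ x, (QF.mk 4 (M.map (algebraMap F K))).form (e x) = (QF.mk 4 !![β, β, 0, 0;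
        0, β * algebraMap F K b, 0, 0; 0, 0, γ, γ; 0, 0, 0, γ * algebraMap F K c]).form x :=
      fun x => E.map_app x
    let i : (Fin 4 → F) →ₗ[F] (Fin 4 → K) := (Algebra.linearMap F K).compLeft (Fin 4)
    let g : (Fin 4 → F) →ₗ[F] (Fin 4 → K) := (e.symm.toLinearMap.restrictScalars F).comp i
    have hg : ∀ z, e (g z) = i z := fun z => e.apply_symm_apply _
    refine ⟨((LinearMap.proj 0).prod (LinearMap.proj 1)).comp g,
      ((LinearMap.proj 2).prod (LinearMap.proj 3)).comp g, fun z h1 h2 => ?_, fun z => ?_⟩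
    · have hgz : g z = 0 := by
        simp at h1 h2
        ext i
        fin_cases i <;> simp [h1, h2]
      have := hg z
      rw [hgz, map_zero] at this
      ext j
      have h3 := congrFun this j
      have h4 : i z j = algebraMap F K (z j) := rfl
      rw [h4] at h3
      exact (map_eq_zero (algebraMap F K)).mp h3.symm
    · have h1 := l_phi (l := l) β γ b c (g z)
      rw [← he, hg] at h1
      have h3 : (QF.mk 4 (M.map (algebraMap F K))).form (i z) =
          algebraMap F K ((QF.mk 4 M).form z) := by
        rw [form_four, form_four]
        simp only [map_sum, map_mul]
        rfl
      rw [h3, h.l_alg] at h1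
      change rho l β b (g z 0, g z 1) = rho l γ c (g z 2, g z 3)
      linear_combination -h1 - (rho l γ c (g z 2, g z 3)) * hF2
  · rintro ⟨g1, g2, hinj, hg⟩
    have := h.fin
    let G : (Fin 4 → F) →ₗ[F] (Fin 4 → K) := LinearMap.pi
      ![(LinearMap.fst F K K).comp g1, (LinearMap.snd F K K).comp g1,
        (LinearMap.fst F K K).comp g2, (LinearMap.snd F K K).comp g2]
    have hG : ∀ z, G z = ![(g1 z).1, (g1 z).2, (g2 z).1, (g2 z).2] := by
      intro z; ext i; fin_cases i <;> rfl
    have hGi : Function.Injective G := by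
      rw [← LinearMap.ker_eq_bot, LinearMap.ker_eq_bot']
      intro z hz
      rw [hG] at hz
      have h0 := congrFun hz 0
      have h1 := congrFun hz 1
      have h2 := congrFun hz 2
      have h3 := congrFun hz 3
      simp at h0 h1 h2 h3
      exact hinj z (Prod.ext h0 h1) (Prod.ext h2 h3)
    have hnd := phi_nondeg h β γ hβ hγ (algebraMap F K b) (algebraMap F K c)
    have hlp := l_phi (l := l) β γ b c
    let Q : QuadraticForm K (Fin 4 → K) := (QF.mk 4 !![β, β, 0, 0;
        0, β * algebraMap F K b, 0, 0; 0, 0, γ, γ; 0, 0, 0, γ * algebraMap F K c]).form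
    change ∀ x : Fin 4 → K, x ≠ 0 → ∃ y, QuadraticMap.polar Q x y ≠ 0 at hnd
    change ∀ x : Fin 4 → K, l (Q x) = _ at hlp
    obtain ⟨bs, hb1, hb2⟩ := descent_basis h Q hnd 4 (by simp) (LinearMap.range G) (by
      rintro _ ⟨z, rfl⟩
      rw [hlp, hG]
      simp
      rw [hg, CharTwo.add_self_eq_zero]) (by rw [LinearMap.finrank_range_of_inj hGi]; simp)
    choose d hd using fun i => h.alg_of _ (hb1 i)
    choose o ho using fun i j => h.alg_of _ (hb2 i j)
    refine ⟨⟨4, !![d 0, o 0 1, o 0 2, o 0 3; 0, d 1, o 1 2, o 1 3; 0, 0, d 2, o 2 3;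
      0, 0, 0, d 3]⟩, ⟨QuadraticMap.IsometryEquiv.symm ⟨bs.equivFun.symm, fun x => ?_⟩⟩⟩
    change Fin 4 → K at x
    change Q (bs.equivFun.symm x) = _
    refine Eq.trans ?_ (form_four _ x).symm
    rw [Module.Basis.equivFun_symm_apply]
    have hadd : ∀ x y, Q (x + y) = Q x + Q y + QuadraticMap.polar Q x y := by
      intro x y; simp [QuadraticMap.polar]
    simp only [Fin.sum_univ_four, hadd, QuadraticMap.polar_add_left,
      QuadraticMap.polar_smul_left, QuadraticMap.polar_smul_right, QuadraticMap.map_smul, hd, ho]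
    simp
    ring

theorem QE.equiv_apply (h : QE a α l) (x y : F) :
    h.equiv (x, y) = x • (1:K) + y • α := rfl

theorem norm_eq (h : QE a α l) (s t : F) :
    Algebra.norm F (algebraMap F K s + algebraMap F K t * α) = s ^ 2 + s * t + a * t ^ 2 := by
  have hF2 : (2 : F) = 0 := CharTwo.two_eq_zero
  have h2 := h.two
  have hα := h.hα
  let bs : Module.Basis (Fin 2) F K := (Module.Basis.finTwoProd F).map h.equiv
  have b0 : bs 0 = 1 := by simp [bs, QE.equiv_apply]
  have b1 : bs 1 = α := by simp [bs, QE.equiv_apply]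
  have hr : ∀ x y : F, bs.equivFun (algebraMap F K x + algebraMap F K y * α) = ![x, y] := by
    intro x y
    rw [← LinearEquiv.eq_symm_apply, Module.Basis.equivFun_symm_apply]
    simp [b0, b1, Algebra.smul_def]
  have hr' : ∀ (x y : F) i, bs.repr (algebraMap F K x + algebraMap F K y * α) i = ![x, y] i := by
    intro x y i
    rw [← hr x y]; rfl
  rw [Algebra.norm_eq_matrix_det bs, Matrix.det_fin_two]
  simp only [Algebra.leftMulMatrix_eq_repr_mul, b0, b1]
  have e1 : (algebraMap F K s + algebraMap F K t * α) * α =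
      algebraMap F K (a * t) + algebraMap F K (s + t) * α := by
    simp only [map_add, map_mul]
    linear_combination algebraMap F K t * hα - algebraMap F K t * α * h2
  rw [mul_one, e1, hr', hr', hr', hr']
  simp
  linear_combination -a * t ^ 2 * hF2

theorem QE_of_finrank (hα : α ^ 2 + α = algebraMap F K a)
    (hfr : Module.finrank F K = 2) (hn : ∀ x : F, algebraMap F K x ≠ α) :
    ∃ l : K →ₗ[F] F, QE a α l := by
  have hli : LinearIndependent F ![(1 : K), α] := by
    rw [LinearIndependent.pair_iff]
    intro x y hxy
    by_cases hy : y = 0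
    · subst hy
      simpa using hxy
    · exfalso
      apply hn (-x / y)
      rw [Algebra.smul_def, Algebra.smul_def, mul_one] at hxy
      have : algebraMap F K y ≠ 0 := by simpa using hy
      rw [map_div₀, map_neg]
      field_simp
      linear_combination -hxy
  have : FiniteDimensional F K := Module.finite_of_finrank_pos (by omega)
  let bs := basisOfLinearIndependentOfCardEqFinrank' _ hli (by simp [hfr])
  have b0 : bs 0 = 1 := by simp [bs]
  have b1 : bs 1 = α := by simp [bs]
  refine ⟨bs.coord 1, hα, ?_, ?_, ?_⟩
  · rw [← b0]; simp
  · rw [← b1]; simp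
  · intro k
    refine ⟨bs.coord 0 k, ?_⟩
    conv_lhs => rw [← bs.sum_repr k]
    simp [Fin.sum_univ_two, b0, b1, Algebra.smul_def]

theorem finrank_AS_le {M : Type} [Field M] [Algebra F M] (x : M) (d : F)
    (hx : x ^ 2 + x = algebraMap F M d) :
    IsIntegral F x ∧ Module.finrank F (IntermediateField.adjoin F {x}) ≤ 2 := by
  have hm : (Polynomial.X ^ 2 + Polynomial.X - Polynomial.C d : Polynomial F).Monic := by
    monicity!
  have hdg : (Polynomial.X ^ 2 + Polynomial.X - Polynomial.C d : Polynomial F).natDegree = 2 := by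
    compute_degree!
  have hev : Polynomial.aeval x (Polynomial.X ^ 2 + Polynomial.X - Polynomial.C d : Polynomial F)
      = 0 := by simp [hx]
  have hint : IsIntegral F x := ⟨_, hm, by simpa [Polynomial.aeval_def] using hev⟩
  refine ⟨hint, ?_⟩
  rw [IntermediateField.adjoin.finrank hint, ← hdg]
  exact Polynomial.natDegree_le_of_dvd (minpoly.dvd F x hev) hm.ne_zero

theorem finrank_K {M : Type} [Field M] [Algebra F M] {b c : F} (α βM γM : M)
    (hα : α ^ 2 + α = algebraMap F M a)
    (hβM : βM ^ 2 + βM = algebraMap F M b)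
    (hγM : γM ^ 2 + γM = algebraMap F M c)
    (hgen : Algebra.adjoin F {α, βM, γM} = ⊤)
    (hdeg : Module.finrank F M = 8) :
    Module.finrank F (IntermediateField.adjoin F {α}) = 2 := by
  obtain ⟨i1, k1⟩ := finrank_AS_le α a hα
  obtain ⟨i2, k2⟩ := finrank_AS_le βM b hβM
  obtain ⟨i3, k3⟩ := finrank_AS_le γM c hγM
  have htop : IntermediateField.adjoin F {α} ⊔ (IntermediateField.adjoin F {βM} ⊔
      IntermediateField.adjoin F {γM}) = (⊤ : IntermediateField F M) := by
    rw [← IntermediateField.adjoin_union, ← IntermediateField.adjoin_union, eq_top_iff]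
    intro x _
    have hx : x ∈ Algebra.adjoin F {α, βM, γM} := by rw [hgen]; trivial
    have := IntermediateField.algebra_adjoin_le_adjoin F _ hx
    rw [Set.insert_eq, Set.insert_eq] at this
    exact this
  have e1 := IntermediateField.finrank_sup_le (IntermediateField.adjoin F {α})
    (IntermediateField.adjoin F {βM} ⊔ IntermediateField.adjoin F {γM})
  have e2 := IntermediateField.finrank_sup_le (IntermediateField.adjoin F {βM})
    (IntermediateField.adjoin F {γM})
  rw [htop, IntermediateField.finrank_top', hdeg] at e1
  have e3 := e2.trans (Nat.mul_le_mul k2 k3)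
  nlinarith

end core4

/-- **Proposition 5.1** (Barry–Laghribi, analogue of Leep–Smith). Let
`M = F(℘⁻¹(a), ℘⁻¹(b), ℘⁻¹(c))` be a separable triquadratic extension of `F`
(characteristic 2), `K = F(α)` with `α² + α = a`, and `β = s + tα`, `γ = u + vα`
nonzero elements of `K`. Then the `K`-form `φ = β[1, b] ⊥ γ[1, c]` is defined over `F`
iff `⟨⟨N_{K/F}(β), b]] ≅ ⟨⟨N_{K/F}(γ), c]]` and, when `tv ≠ 0`, `tv` is represented by
`⟨⟨N_{K/F}(β), b]]` over `F`. -/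
theorem stmt_15 (F : Type) [Field F] [CharP F 2]
    (a b c : F)
    (M : Type) [Field M] [Algebra F M] (α βM γM : M)
    (hα : α ^ 2 + α = algebraMap F M a)
    (hβM : βM ^ 2 + βM = algebraMap F M b)
    (hγM : γM ^ 2 + γM = algebraMap F M c)
    (hgen : Algebra.adjoin F {α, βM, γM} = ⊤)
    (hdeg : Module.finrank F M = 8)
    (K : IntermediateField F M) (hK : K = IntermediateField.adjoin F {α})
    (s t u v : F) (β γ : ↥K)
    (hβ : (β : M) = algebraMap F M s + algebraMap F M t * α)
    (hγ : (γ : M) = algebraMap F M u + algebraMap F M v * α)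
    (hβ0 : β ≠ 0) (hγ0 : γ ≠ 0) :
    (∃ ψ : QF F,
        QF.Isom
          (QF.oplus (QF.sm β (QF.bin 1 (algebraMap F ↥K b)))
            (QF.sm γ (QF.bin 1 (algebraMap F ↥K c))))
          (ψ.bc ↥K)) ↔
      (QF.Isom (QF.qpf [Algebra.norm F β] b) (QF.qpf [Algebra.norm F γ] c) ∧
        (t * v ≠ 0 → ∃ w, (QF.qpf [Algebra.norm F β] b).form w = t * v)) := by
  have hfr : Module.finrank F K = 2 := by
    rw [hK]; exact finrank_K α βM γM hα hβM hγM hgen hdeg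
  have hαK : α ∈ K := by
    rw [hK]; exact IntermediateField.mem_adjoin_simple_self F α
  let αK : K := ⟨α, hαK⟩
  have hαK' : αK ^ 2 + αK = algebraMap F K a := Subtype.ext hα
  obtain ⟨l, h⟩ := QE_of_finrank hαK' hfr (by
    intro x hx
    have hx' : algebraMap F M x = α := congrArg Subtype.val hx
    have : IntermediateField.adjoin F {α} = ⊥ := by
      rw [IntermediateField.adjoin_simple_eq_bot_iff, ← hx']
      exact IntermediateField.algebraMap_mem _ x
    rw [hK, this] at hfr
    simp at hfr)
  have hβ' : β = algebraMap F K s + algebraMap F K t * αK := Subtype.ext hβ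
  have hγ' : γ = algebraMap F K u + algebraMap F K v * αK := Subtype.ext hγ
  have := h.fin
  have hm : Algebra.norm F β ≠ 0 := Algebra.norm_ne_zero_iff.mpr hβ0
  have hn : Algebra.norm F γ ≠ 0 := Algebra.norm_ne_zero_iff.mpr hγ0
  rw [defined_iff h β γ hβ0 hγ0, isom_iff, rep_iff]
  clear hβ hγ
  subst hβ' hγ'
  rw [norm_eq h] at hm hn ⊢
  rw [norm_eq h]
  constructor
  · rintro ⟨g1, g2, hinj, hg⟩
    obtain ⟨r1, r2⟩ := forward_core h b c s t u v hm hn hβ0 hγ0 g1 g2 hinj hg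
    exact ⟨r1, fun _ => r2⟩
  · rintro ⟨r1, r2⟩
    exact backward_core h b c s t u v hm hn r1 r2

end BL
end
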